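/- arXiv:2306.09271 — 4 statements merged into one kernel-verified Lean document; each statement's English description precedes it below -/
import Mathlib

section
/- Let N ≥ 2 and n ≥ 10 be integers. If the N-th cyclotomic polynomial Φ_N(X) divides N_n(X) = X^{n-2}(X³ − X − 1) + (X³ + X² − 1) in ℤ[X], then N ∈ {2, 3, 5, 8, 12, 18, 30}. -/
open Polynomial

/-- For `n ≥ 3`, define `N_n(X) = X ^ (n - 2) * (X ^ 3 - X - 1) + (X ^ 3 + X ^ 2 - 1) ∈ ℤ[X]`. -/
noncomputable def Nn (n : ℕ) : Polynomial ℤ :=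
  X ^ (n - 2) * (X ^ 3 - X - 1) + (X ^ 3 + X ^ 2 - 1)

theorem Nn_eval_eq_zero_of_isPrimitiveRoot {N n : ℕ} (hN : 0 < N)
    (hdvd : cyclotomic N ℤ ∣ Nn n) {ω : ℂ} (hω : IsPrimitiveRoot ω N) :
    ω ^ (n - 2) * (ω ^ 3 - ω - 1) + (ω ^ 3 + ω ^ 2 - 1) = 0 := by
  obtain ⟨q, hq⟩ := hdvd
  have hroot : aeval ω (cyclotomic N ℤ) = 0 := by
    rw [aeval_def, ← eval_map, algebraMap_int_eq, map_cyclotomic_int]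
    exact hω.isRoot_cyclotomic hN
  have h : aeval ω (Nn n) = 0 := by rw [hq, map_mul, hroot, zero_mul]
  simpa [Nn] using h

theorem orderOf_eq_three {x : ℂ} (h : x ^ 2 + x + 1 = 0) : orderOf x = 3 := by
  have : Fact (Nat.Prime 3) := ⟨Nat.prime_three⟩
  refine orderOf_eq_prime (by linear_combination (x - 1) * h) ?_
  rintro rfl
  norm_num at h

theorem orderOf_eq_five {x : ℂ} (h : x ^ 4 + x ^ 3 + x ^ 2 + x + 1 = 0) : orderOf x = 5 := by
  have : Fact (Nat.Prime 5) := ⟨Nat.prime_five⟩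
  refine orderOf_eq_prime (by linear_combination (x - 1) * h) ?_
  rintro rfl
  norm_num at h

theorem orderOf_eq_eight {x : ℂ} (h : x ^ 4 = -1) : orderOf x = 8 := by
  have : Fact (Nat.Prime 2) := ⟨Nat.prime_two⟩
  refine orderOf_eq_prime_pow (p := 2) (n := 2) ?_ ?_
  · norm_num [h]
  · norm_num
    linear_combination (x ^ 4 - 1) * h

theorem orderOf_eq_twelve {x : ℂ} (h : x ^ 4 - x ^ 2 + 1 = 0) : orderOf x = 12 := by
  refine orderOf_eq_of_pow_and_pow_div_prime (by norm_num) (by grind) fun p hp hdvd => ?_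
  have : p ∈ Nat.primeFactors 12 := Nat.mem_primeFactors.2 ⟨hp, hdvd, by norm_num⟩
  rw [show Nat.primeFactors 12 = {2, 3} by decide +kernel] at this
  simp only [Finset.mem_insert, Finset.mem_singleton] at this
  rcases this with rfl | rfl <;> norm_num <;> grind

theorem orderOf_eq_eighteen {x : ℂ} (h : x ^ 6 - x ^ 3 + 1 = 0) : orderOf x = 18 := by
  refine orderOf_eq_of_pow_and_pow_div_prime (by norm_num) (by grind) fun p hp hdvd => ?_
  have : p ∈ Nat.primeFactors 18 := Nat.mem_primeFactors.2 ⟨hp, hdvd, by norm_num⟩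
  rw [show Nat.primeFactors 18 = {2, 3} by decide +kernel] at this
  simp only [Finset.mem_insert, Finset.mem_singleton] at this
  rcases this with rfl | rfl <;> norm_num <;> grind

theorem orderOf_eq_thirty {x : ℂ} (h : x ^ 8 + x ^ 7 - x ^ 5 - x ^ 4 - x ^ 3 + x + 1 = 0) :
    orderOf x = 30 := by
  refine orderOf_eq_of_pow_and_pow_div_prime (by norm_num) (by grind) fun p hp hdvd => ?_
  have : p ∈ Nat.primeFactors 30 := Nat.mem_primeFactors.2 ⟨hp, hdvd, by norm_num⟩
  rw [show Nat.primeFactors 30 = {2, 3, 5} by decide +kernel] at this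
  simp only [Finset.mem_insert, Finset.mem_singleton] at this
  rcases this with rfl | rfl | rfl <;> norm_num <;> grind

/-- If `N ≥ 2`, `n ≥ 10` and the `N`-th cyclotomic polynomial divides `N_n`,
then `N ∈ {2, 3, 5, 8, 12, 18, 30}`. -/
theorem cyclotomic_dvd_Nn (N n : ℕ) (hN : 2 ≤ N) (hn : 10 ≤ n)
    (hdvd : cyclotomic N ℤ ∣ Nn n) :
    N ∈ ({2, 3, 5, 8, 12, 18, 30} : Set ℕ) := by
  have hN0 : 0 < N := by omega
  obtain ⟨x, hx⟩ : ∃ x : ℂ, IsPrimitiveRoot x N := ⟨_, Complex.isPrimitiveRoot_exp N hN0.ne'⟩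
  have hroot {ω : ℂ} (hω : IsPrimitiveRoot ω N) :=
    Nn_eval_eq_zero_of_isPrimitiveRoot hN0 hdvd hω
  have hord : N = orderOf x := hx.eq_orderOf
  have hx0 : x ≠ 0 := hx.ne_zero hN0.ne'
  have hx1 : x - 1 ≠ 0 := sub_ne_zero.2 (hx.ne_one hN)
  have h := hroot hx
  have hneg_one (hxx : x + 1 = 0) : N = 2 := by
    rw [hord, eq_neg_of_add_eq_zero_left hxx, orderOf_neg_one]
    simp [ringChar.eq_zero]
  simp only [Set.mem_insert_iff, Set.mem_singleton_iff]
  rcases Nat.even_or_odd N with ⟨k, hk⟩ | hodd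
  · have hxk : x ^ k = -1 := (hx.pow hN0 (show N = k * 2 by omega)).eq_neg_one_of_two_right
    rcases Nat.even_or_odd k with hke | hko
    · -- `4 ∣ N`: `-x` is again a primitive root.
      have hneg : IsPrimitiveRoot (-x) N := by
        have hcop : Nat.Coprime (k + 1) N := by
          rw [show N = 2 * k by omega]
          exact Nat.Coprime.mul_right (Nat.coprime_two_right.2 hke.add_one) (by simp)
        simpa [pow_succ, hxk] using hx.pow_of_coprime _ hcop
      have h' := hroot hneg
      rcases Nat.even_or_odd (n - 2) with hm | hm
      · have hinv := hroot hx.inv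
        rw [hm.neg_pow] at h'
        have hy : x ^ (n - 2) = x ^ 2 - 1 := by linear_combination (-1 / 2) * (h + h')
        have hinv' := hroot hneg.inv
        rw [inv_neg, hm.neg_pow] at hinv'
        have hy' : x⁻¹ ^ (n - 2) = x⁻¹ ^ 2 - 1 := by
          linear_combination (-1 / 2) * (hinv + hinv')
        have hmul : (x ^ 2 - 1) * (x⁻¹ ^ 2 - 1) = 1 := by
          rw [← hy, ← hy', ← mul_pow, mul_inv_cancel₀ hx0, one_pow]
        have := orderOf_eq_twelve (x := x) (by field_simp at hmul; linear_combination -hmul)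
        omega
      · rw [hm.neg_pow] at h'
        have hprod : (x - 1) * ((x + 1) * (x * x ^ (n - 2) + 1)) = 0 := by
          linear_combination (1 / 2) * (h + h')
        rcases mul_eq_zero.1 ((mul_eq_zero.1 hprod).resolve_left hx1) with h1 | h1
        · exact .inl (hneg_one h1)
        · have := orderOf_eq_eight (x := x)
            (by linear_combination x * h - (x ^ 3 - x - 1) * h1)
          omega
    · -- `N ≡ 2 mod 4`: `-x ^ 2` is again a primitive root.
      have hsq : IsPrimitiveRoot (-x ^ 2) N := by
        have hcop : Nat.Coprime (k + 2) N := by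
          rw [show N = 2 * k by omega]
          exact Nat.Coprime.mul_right (Nat.coprime_two_right.2 (hko.add_even even_two))
            (by simpa using Nat.coprime_two_left.2 hko)
        simpa [pow_add, hxk] using hx.pow_of_coprime _ hcop
      have h' := hroot hsq
      rcases Nat.even_or_odd (n - 2) with hm | hm
      · rw [hm.neg_pow, pow_right_comm] at h'
        have hprod : (x ^ 4 - x ^ 2 + 1) *
            (x ^ 8 + x ^ 7 - x ^ 5 - x ^ 4 - x ^ 3 + x + 1) = 0 := by
          linear_combination (-1 / 2) * ((x ^ 3 - x - 1) ^ 2 * h' - (-x ^ 6 + x ^ 2 - 1) *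
            (x ^ (n - 2) * (x ^ 3 - x - 1) - (x ^ 3 + x ^ 2 - 1)) * h)
        rcases mul_eq_zero.1 hprod with h1 | h1
        · have := orderOf_eq_twelve h1
          omega
        · have := orderOf_eq_thirty h1
          omega
      · rw [hm.neg_pow, pow_right_comm] at h'
        have hprod : x * ((x - 1) * ((x + 1) ^ 3 * (x ^ 6 - x ^ 3 + 1))) = 0 := by
          linear_combination (1 / 2) * ((x ^ 3 - x - 1) ^ 2 * h' + (-x ^ 6 + x ^ 2 - 1) *
            (x ^ (n - 2) * (x ^ 3 - x - 1) - (x ^ 3 + x ^ 2 - 1)) * h)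
        have hprod' := (mul_eq_zero.1 ((mul_eq_zero.1 hprod).resolve_left hx0)).resolve_left hx1
        rcases mul_eq_zero.1 hprod' with h1 | h1
        · exact .inl (hneg_one (pow_eq_zero_iff (by norm_num) |>.1 h1))
        · have := orderOf_eq_eighteen h1
          omega
  · -- `N` odd: `x ^ 2` is again a primitive root.
    have h' := hroot (hx.pow_of_coprime 2 (Nat.coprime_two_left.2 hodd))
    rw [pow_right_comm] at h'
    have hprod : (x - 1) ^ 3 * ((x + 1) * ((x ^ 2 + x + 1) ^ 2 *
        (x ^ 4 + x ^ 3 + x ^ 2 + x + 1))) = 0 := by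
      linear_combination (1 / 2) * ((x ^ 3 - x - 1) ^ 2 * h' - (x ^ 6 - x ^ 2 - 1) *
        (x ^ (n - 2) * (x ^ 3 - x - 1) - (x ^ 3 + x ^ 2 - 1)) * h)
    rcases mul_eq_zero.1 ((mul_eq_zero.1 hprod).resolve_left (pow_ne_zero 3 hx1)) with h1 | h1
    · exact .inl (hneg_one h1)
    · rcases mul_eq_zero.1 h1 with h2 | h2
      · have := orderOf_eq_three (pow_eq_zero_iff (by norm_num) |>.1 h2)
        omega
      · have := orderOf_eq_five h2
        omega
end

section
/- For every integer n ≥ 10, the polynomial N_n(X) = X^{n-2}(X³ − X − 1) + (X³ + X² − 1) is squarefree (all of its complex roots are simple), and for every integer m ≥ 4, the polynomial Q_m(X) = X^{m-3}(X³ − X − 1) − (X³ + X² − 1) is squarefree (all of its complex roots are simple). -/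
open Polynomial

/-- For `m ≥ 4`, define `Q_m(X) = X ^ (m - 3) * (X ^ 3 - X - 1) - (X ^ 3 + X ^ 2 - 1) ∈ ℤ[X]`. -/
noncomputable def Qm (m : ℕ) : Polynomial ℤ :=
  X ^ (m - 3) * (X ^ 3 - X - 1) - (X ^ 3 + X ^ 2 - 1)

theorem plastic_roots : ∃ (α : ℝ) (β : ℂ), 13 / 10 < α ∧ α < 7 / 5 ∧ α ^ 3 = α + 1 ∧
    β + starRingEnd ℂ β = -(α : ℂ) ∧ β * starRingEnd ℂ β = (α : ℂ) ^ 2 - 1 := by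
  have hc : ContinuousOn (fun x : ℝ => x ^ 3 - x - 1) (Set.Icc (13 / 10) (7 / 5)) := by fun_prop
  obtain ⟨α, ⟨h1, h2⟩, h3⟩ := intermediate_value_Ioo (by norm_num) hc
    (show (0 : ℝ) ∈ Set.Ioo _ _ by constructor <;> norm_num)
  have hs : 0 ≤ 3 * α ^ 2 - 4 := by nlinarith
  have hs' := Real.sq_sqrt hs
  refine ⟨α, ⟨-α / 2, √(3 * α ^ 2 - 4) / 2⟩, h1, h2, by simp only at h3; linarith, ?_, ?_⟩
  · apply Complex.ext <;> simp
  · apply Complex.ext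
    · simp [← Complex.ofReal_pow]
      nlinarith
    · simp [← Complex.ofReal_pow]
      ring

theorem inv_sub_self_add_lt {x y : ℝ} (hx : 0 < x) (hx1 : x < 1) (hy : 0 < y) (hy1 : y < 1) :
    (x⁻¹ - x) + (y⁻¹ - y) < (x * y)⁻¹ - x * y := by
  have hxy : x * y < 1 := by nlinarith
  have h : (x * y)⁻¹ - x * y - ((x⁻¹ - x) + (y⁻¹ - y))
      = (1 - x) * (1 - y) * (1 - x * y) / (x * y) := by
    field_simp
    ring
  have : 0 < (1 - x) * (1 - y) * (1 - x * y) / (x * y) :=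
    div_pos (mul_pos (mul_pos (by linarith) (by linarith)) (by linarith)) (mul_pos hx hy)
  linarith

theorem mul_inv_sub_self_le_pow {x : ℝ} (hx : 0 < x) (hx1 : x < 1) (k : ℕ) :
    ((k : ℝ) + 1) * (x⁻¹ - x) ≤ (x ^ (k + 1))⁻¹ - x ^ (k + 1) := by
  induction k with
  | zero => simp
  | succ k ih =>
    have h := inv_sub_self_add_lt (pow_pos hx (k + 1))
      (pow_lt_one₀ hx.le hx1 (Nat.succ_ne_zero k)) hx hx1
    rw [← pow_succ] at h
    push_cast
    linarith

/-- The infinitesimal Schwarz–Pick inequality for a Blaschke product with the factor `z ^ (k + 1)`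
and two further factors, at a point of modulus `r < 1`. -/
theorem blaschke_lt_of_lt_one {r p a A A' B B' C C' : ℝ} (k : ℕ) (hr : 0 < r) (hr1 : r < 1)
    (hp : 0 < p) (hA : 0 < A) (hA' : 0 < A') (hB : 0 < B) (hB' : 0 < B') (hC : 0 < C)
    (hC' : 0 < C') (eA : A ^ 2 - A' ^ 2 = a * (1 - r ^ 2)) (eB : B' ^ 2 - B ^ 2 = p * (1 - r ^ 2))
    (eC : C' ^ 2 - C ^ 2 = p * (1 - r ^ 2)) (e : r ^ (k + 1) * (A * B * C) = A' * B' * C') :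
    (k : ℝ) + 1 + r * p / (B * B') + r * p / (C * C') < r * a / (A * A') := by
  have hr2 : 0 < 1 - r ^ 2 := by nlinarith
  have lt1 : ∀ {U V : ℝ}, 0 < U → 0 < V → V ^ 2 - U ^ 2 = p * (1 - r ^ 2) → U / V < 1 := by
    intro U V hU hV h
    rw [div_lt_one hV]
    nlinarith [mul_pos hp hr2]
  have key : ∀ {U V c : ℝ}, 0 < U → 0 < V → V ^ 2 - U ^ 2 = c * (1 - r ^ 2) →
      r * c / (U * V) = r / (1 - r ^ 2) * ((U / V)⁻¹ - U / V) := by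
    intro U V c hU hV h
    have : c = (V ^ 2 - U ^ 2) / (1 - r ^ 2) := by rw [h]; field_simp
    rw [this]
    field_simp
  have hk : (k : ℝ) + 1 = r / (1 - r ^ 2) * (((k : ℝ) + 1) * (r⁻¹ - r)) := by
    field_simp
  have hd : A' / A = r ^ (k + 1) * (B / B') * (C / C') := by
    field_simp
    linarith
  rw [key hB hB' eB, key hC hC' eC, mul_comm A, key hA' hA eA, hk, ← mul_add, ← mul_add]
  refine mul_lt_mul_of_pos_left ?_ (div_pos hr hr2)
  have b0 := div_pos hB hB'
  have c0 := div_pos hC hC'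
  have b1 := lt1 hB hB' eB
  have c1 := lt1 hC hC' eC
  have r0 := pow_pos hr (k + 1)
  have r1 := pow_lt_one₀ hr.le hr1 (Nat.succ_ne_zero k)
  have i1 := inv_sub_self_add_lt r0 r1 b0 b1
  have i2 := inv_sub_self_add_lt (mul_pos r0 b0) (mul_lt_one_of_nonneg_of_lt_one_left r0.le r1 b1.le)
    c0 c1
  have i3 := mul_inv_sub_self_le_pow hr hr1 k
  rw [hd]
  linarith

theorem blaschke_lt_of_ne_one {r p a A A' B B' C C' : ℝ} (k : ℕ) (hr : 0 < r) (hr1 : r ≠ 1)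
    (hp : 0 < p) (hA : 0 < A) (hA' : 0 < A') (hB : 0 < B) (hB' : 0 < B') (hC : 0 < C)
    (hC' : 0 < C') (eA : A ^ 2 - A' ^ 2 = a * (1 - r ^ 2)) (eB : B' ^ 2 - B ^ 2 = p * (1 - r ^ 2))
    (eC : C' ^ 2 - C ^ 2 = p * (1 - r ^ 2)) (e : r ^ (k + 1) * (A * B * C) = A' * B' * C') :
    (k : ℝ) + 1 + r * p / (B * B') + r * p / (C * C') < r * a / (A * A') := by
  rcases lt_or_gt_of_ne hr1 with h | h
  · exact blaschke_lt_of_lt_one k hr h hp hA hA' hB hB' hC hC' eA eB eC e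
  · have hinv : ∀ {U V c : ℝ}, V ^ 2 - U ^ 2 = c * (1 - r ^ 2) →
        U ^ 2 - V ^ 2 = r ^ 2 * c * (1 - r⁻¹ ^ 2) := by
      intro U V c h
      field_simp
      linarith
    have e' : r⁻¹ ^ (k + 1) * (A' * B' * C') = A * B * C := by
      rw [← e, inv_pow]
      field_simp
    have := blaschke_lt_of_lt_one k (inv_pos.2 hr) (inv_lt_one_of_one_lt₀ h)
      (mul_pos (pow_pos hr 2) hp) hA' hA hB' hB hC' hC (hinv eA) (hinv eB) (hinv eC) e'
    have hs : ∀ c : ℝ, r⁻¹ * (r ^ 2 * c) = r * c := by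
      intro c
      field_simp
    rwa [hs, hs, mul_comm B', mul_comm C', mul_comm A'] at this

theorem sq_norm_one_sub_conj_mul_sub (z β : ℂ) :
    ‖1 - starRingEnd ℂ β * z‖ ^ 2 - ‖z - β‖ ^ 2 = (1 - ‖β‖ ^ 2) * (1 - ‖z‖ ^ 2) := by
  simp only [← Complex.normSq_eq_norm_sq, Complex.normSq_apply]
  simp
  ring

theorem sub_mul_one_sub_conj_mul {z : ℂ} (hz : ‖z‖ = 1) (β : ℂ) :
    (z - β) * (1 - starRingEnd ℂ β * z) = z * ((‖z - β‖ ^ 2 : ℝ) : ℂ) := by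
  have h : z * starRingEnd ℂ z = 1 := by rw [Complex.mul_conj']; simp [hz]
  rw [Complex.ofReal_pow, ← Complex.mul_conj', map_sub]
  linear_combination -(z - β) * h

theorem log_deriv_eq_zero {z α β γ ε : ℂ} {k : ℕ} (hz : z ≠ 0)
    (hα : z - α ≠ 0) (hβ : z - β ≠ 0) (hγ : z - γ ≠ 0)
    (hα' : 1 - α * z ≠ 0) (hβ' : 1 - β * z ≠ 0) (hγ' : 1 - γ * z ≠ 0)
    (hf : z ^ 3 - z - 1 = (z - α) * (z - β) * (z - γ))
    (hf' : 3 * z ^ 2 - 1 = (z - β) * (z - γ) + (z - α) * (z - γ) + (z - α) * (z - β))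
    (hg : z ^ 3 + z ^ 2 - 1 = -((1 - α * z) * (1 - β * z) * (1 - γ * z)))
    (hg' : 3 * z ^ 2 + 2 * z = α * ((1 - β * z) * (1 - γ * z)) + β * ((1 - α * z) * (1 - γ * z))
      + γ * ((1 - α * z) * (1 - β * z)))
    (h0 : z ^ (k + 1) * (z ^ 3 - z - 1) + ε * (z ^ 3 + z ^ 2 - 1) = 0)
    (h1 : (k + 1) * z ^ k * (z ^ 3 - z - 1) + z ^ (k + 1) * (3 * z ^ 2 - 1)
      + ε * (3 * z ^ 2 + 2 * z) = 0) :
    (k : ℂ) + 1 + z * (1 - β * γ) / ((z - β) * (1 - γ * z))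
      + z * (1 - β * γ) / ((z - γ) * (1 - β * z))
      - z * (α ^ 2 - 1) / ((z - α) * (1 - α * z)) = 0 := by
  have hR : ((k : ℂ) + 1) * (z ^ 3 - z - 1) * (z ^ 3 + z ^ 2 - 1)
      + z * ((3 * z ^ 2 - 1) * (z ^ 3 + z ^ 2 - 1) - (z ^ 3 - z - 1) * (3 * z ^ 2 + 2 * z)) = 0 := by
    refine mul_left_cancel₀ (pow_ne_zero (k + 1) hz) ?_
    linear_combination z * (z ^ 3 + z ^ 2 - 1) * h1 - z * (3 * z ^ 2 + 2 * z) * h0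
  rw [hf, hf', hg, hg'] at hR
  rw [mul_comm _ z] at hα' hβ' hγ'
  field_simp
  linear_combination -hR

theorem no_double_root {z ε : ℂ} {k : ℕ} (hε : ‖ε‖ = 1)
    (hk : ‖z‖ = 1 → 8 ≤ k + 1)
    (h0 : z ^ (k + 1) * (z ^ 3 - z - 1) + ε * (z ^ 3 + z ^ 2 - 1) = 0)
    (h1 : (k + 1) * z ^ k * (z ^ 3 - z - 1) + z ^ (k + 1) * (3 * z ^ 2 - 1)
      + ε * (3 * z ^ 2 + 2 * z) = 0) : False := by
  obtain ⟨α, β, a1, a2, a3, hs, hp⟩ := plastic_roots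
  obtain ⟨γ, hγ⟩ : ∃ γ, γ = starRingEnd ℂ β := ⟨_, rfl⟩
  have hγβ : starRingEnd ℂ γ = β := by simp [hγ]
  rw [← hγ] at hs hp
  have a3' : (α : ℂ) ^ 3 = α + 1 := by exact_mod_cast a3
  have hε0 : ε ≠ 0 := by
    rintro rfl
    simp at hε
  have hz : z ≠ 0 := by
    rintro rfl
    simp [hε0] at h0
  have hg0 : z ^ 3 + z ^ 2 - 1 ≠ 0 := by
    intro hg
    rw [hg, mul_zero, add_zero] at h0
    have hf := (mul_eq_zero.1 h0).resolve_left (pow_ne_zero _ hz)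
    have hz1 : z + 1 = 0 := by
      refine (mul_eq_zero.1 (?_ : z * (z + 1) = 0)).resolve_left hz
      linear_combination hg - hf
    have hz2 : z = -1 := by linear_combination hz1
    rw [hz2] at hg
    norm_num at hg
  have hf0 : z ^ 3 - z - 1 ≠ 0 := by
    intro hf
    rw [hf, mul_zero, zero_add] at h0
    exact hg0 ((mul_eq_zero.1 h0).resolve_left hε0)
  have hf : z ^ 3 - z - 1 = (z - α) * (z - β) * (z - γ) := by
    linear_combination (z ^ 2 - z * α) * hs + (α - z) * hp + a3'
  have hf' : 3 * z ^ 2 - 1 = (z - β) * (z - γ) + (z - α) * (z - γ) + (z - α) * (z - β) := by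
    linear_combination (2 * z - α) * hs - hp
  have hg : z ^ 3 + z ^ 2 - 1 = -((1 - α * z) * (1 - β * z) * (1 - γ * z)) := by
    linear_combination (-z + z ^ 2 * α) * hs + (z ^ 2 - α * z ^ 3) * hp - z ^ 3 * a3'
  have hg' : 3 * z ^ 2 + 2 * z = α * ((1 - β * z) * (1 - γ * z))
      + β * ((1 - α * z) * (1 - γ * z)) + γ * ((1 - α * z) * (1 - β * z)) := by
    linear_combination (-1 + 2 * z * α) * hs + (2 * z - 3 * α * z ^ 2) * hp - 3 * z ^ 2 * a3'
  have hf1 := hf0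
  have hg1 := hg0
  rw [hf] at hf1
  rw [hg] at hg1
  simp only [ne_eq, neg_eq_zero, mul_eq_zero, not_or] at hf1 hg1
  obtain ⟨⟨hα0, hβ0⟩, hγ0⟩ := hf1
  obtain ⟨⟨hα1, hβ1⟩, hγ1⟩ := hg1
  have hL := log_deriv_eq_zero hz hα0 hβ0 hγ0 hα1 hβ1 hγ1 hf hf' hg hg' h0 h1
  have hβn : ‖β‖ ^ 2 = α ^ 2 - 1 := by
    have : ((‖β‖ ^ 2 : ℝ) : ℂ) = ((α ^ 2 - 1 : ℝ) : ℂ) := by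
      push_cast
      rw [← Complex.mul_conj', ← hγ, hp]
    exact_mod_cast this
  have hγn : ‖γ‖ ^ 2 = α ^ 2 - 1 := by rw [hγ, RCLike.norm_conj, hβn]
  have hq : 0 < 2 - α ^ 2 := by nlinarith
  have ha : 0 < α ^ 2 - 1 := by nlinarith
  have hqc : 1 - β * γ = ((2 - α ^ 2 : ℝ) : ℂ) := by
    push_cast
    linear_combination -hp
  have hac : (α : ℂ) ^ 2 - 1 = ((α ^ 2 - 1 : ℝ) : ℂ) := by push_cast; rfl
  rw [hqc, hac] at hL
  by_cases hr : ‖z‖ = 1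
  · have tα := sub_mul_one_sub_conj_mul hr (α : ℂ)
    have tβ := sub_mul_one_sub_conj_mul hr β
    have tγ := sub_mul_one_sub_conj_mul hr γ
    rw [Complex.conj_ofReal] at tα
    rw [← hγ] at tβ
    rw [hγβ] at tγ
    rw [tα, tβ, tγ, mul_div_mul_left _ _ hz, mul_div_mul_left _ _ hz, mul_div_mul_left _ _ hz] at hL
    have hL' : (k : ℝ) + 1 + (2 - α ^ 2) / ‖z - β‖ ^ 2 + (2 - α ^ 2) / ‖z - γ‖ ^ 2
        - (α ^ 2 - 1) / ‖z - α‖ ^ 2 = 0 := by exact_mod_cast hL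
    have pβ : 0 < (2 - α ^ 2) / ‖z - β‖ ^ 2 := div_pos hq (pow_pos (norm_pos_iff.2 hβ0) 2)
    have pγ : 0 < (2 - α ^ 2) / ‖z - γ‖ ^ 2 := div_pos hq (pow_pos (norm_pos_iff.2 hγ0) 2)
    have hd : α - 1 ≤ ‖z - α‖ := by
      have := norm_sub_norm_le (α : ℂ) z
      rw [norm_sub_rev, hr, Complex.norm_real, Real.norm_of_nonneg (by linarith)] at this
      exact this
    have hlt : (α ^ 2 - 1) / ‖z - α‖ ^ 2 < 8 := by
      rw [div_lt_iff₀ (pow_pos (norm_pos_iff.2 hα0) 2)]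
      nlinarith
    have hk' : (8 : ℝ) ≤ k + 1 := by exact_mod_cast hk hr
    linarith
  · have tα := sq_norm_one_sub_conj_mul_sub z (α : ℂ)
    have tβ := sq_norm_one_sub_conj_mul_sub z β
    have tγ := sq_norm_one_sub_conj_mul_sub z γ
    rw [Complex.conj_ofReal, Complex.norm_real, Real.norm_eq_abs, sq_abs] at tα
    rw [← hγ, hβn] at tβ
    rw [hγβ, hγn] at tγ
    have hprod : ‖z‖ ^ (k + 1) * (‖z - α‖ * ‖z - β‖ * ‖z - γ‖)
        = ‖1 - α * z‖ * ‖1 - γ * z‖ * ‖1 - β * z‖ := by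
      have h := congrArg norm (eq_neg_of_add_eq_zero_left h0)
      rw [hf, hg] at h
      simp only [norm_neg, norm_mul, norm_pow, hε, one_mul] at h
      linarith
    have hlt := blaschke_lt_of_ne_one (a := α ^ 2 - 1) (p := 2 - α ^ 2) k (norm_pos_iff.2 hz) hr hq
      (norm_pos_iff.2 hα0) (norm_pos_iff.2 hα1) (norm_pos_iff.2 hβ0) (norm_pos_iff.2 hγ1)
      (norm_pos_iff.2 hγ0) (norm_pos_iff.2 hβ1) (by linarith) (by linarith) (by linarith) hprod
    have hn := congrArg norm (sub_eq_zero.1 hL)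
    have hle := hn.symm.trans_le ((norm_add_le _ _).trans (add_le_add_left (norm_add_le _ _) _))
    have hkn : ‖(k : ℂ) + 1‖ = k + 1 := by exact_mod_cast Complex.norm_natCast (k + 1)
    simp only [norm_div, norm_mul, Complex.norm_real, Real.norm_of_nonneg hq.le,
      Real.norm_of_nonneg ha.le, hkn] at hle
    linarith

theorem no_double_root_of_lt_seven {z : ℂ} {k : ℕ} (hk : k < 7)
    (h0 : z ^ (k + 1) * (z ^ 3 - z - 1) + (-1) * (z ^ 3 + z ^ 2 - 1) = 0)
    (h1 : (k + 1) * z ^ k * (z ^ 3 - z - 1) + z ^ (k + 1) * (3 * z ^ 2 - 1)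
      + (-1) * (3 * z ^ 2 + 2 * z) = 0) : False := by
  have hfalse : ∀ L : ℂ, L ≠ 0 → L = 0 → False := fun _ h h' => h h'
  interval_cases k <;> norm_num only [Nat.cast_ofNat] at h0 h1
  · refine hfalse 34 (by norm_num) ?_
    linear_combination (28 - 7 * z - 12 * z ^ 2) * h0
      + (-6 - 11 * z + z ^ 2 + 3 * z ^ 3) * h1
  · refine hfalse 39 (by norm_num) ?_
    linear_combination (39 - 16 * z + 10 * z ^ 2 - 20 * z ^ 3) * h0
      + (-4 - 11 * z - 2 * z ^ 3 + 4 * z ^ 4) * h1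
  · refine hfalse 74 (by norm_num) ?_
    linear_combination (74 - 10 * z + 10 * z ^ 2 + 6 * z ^ 3 - 42 * z ^ 4) * h0
      + (-5 - 17 * z - 5 * z ^ 2 - 4 * z ^ 3 - z ^ 4 + 7 * z ^ 5) * h1
  · refine hfalse 1850 (by norm_num) ?_
    linear_combination (1850 - 268 * z + 676 * z ^ 2 - 222 * z ^ 3 - 413 * z ^ 4 - 532 * z ^ 5) * h0
      + (-134 - 386 * z - 55 * z ^ 2 - 146 * z ^ 3 + 10 * z ^ 4 + 59 * z ^ 5 + 76 * z ^ 6) * h1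
  · refine hfalse 5554 (by norm_num) ?_
    linear_combination (5554 - 696 * z + 2700 * z ^ 2 + 1395 * z ^ 3 - 1686 * z ^ 4 + 1200 * z ^ 5 - 3416 * z ^ 6) * h0
      + (-348 - 905 * z - 374 * z ^ 2 - 414 * z ^ 3 - 297 * z ^ 4 + 104 * z ^ 5 - 150 * z ^ 6 + 427 * z ^ 7) * h1
  · refine hfalse 95893 (by norm_num) ?_
    linear_combination (95893 - 10348 * z + 46941 * z ^ 2 + 27420 * z ^ 3 + 10485 * z ^ 4 + 13120 * z ^ 5 - 23193 * z ^ 6 - 47556 * z ^ 7) * h0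
      + (-5174 - 16715 * z - 3990 * z ^ 2 - 7069 * z ^ 3 - 4495 * z ^ 4 - 3499 * z ^ 5 - 2632 * z ^ 6 + 2577 * z ^ 7 + 5284 * z ^ 8) * h1
  · refine hfalse 44884 (by norm_num) ?_
    linear_combination (44884 - 6184 * z + 22000 * z ^ 2 + 14920 * z ^ 3 + 5610 * z ^ 4 + 24597 * z ^ 5 - 10744 * z ^ 6 - 7960 * z ^ 7 - 22270 * z ^ 8) * h0
      + (-3092 - 6804 * z - 1684 * z ^ 2 - 2577 * z ^ 3 - 2296 * z ^ 4 - 1371 * z ^ 5 - 3287 * z ^ 6 + 629 * z ^ 7 + 796 * z ^ 8 + 2227 * z ^ 9) * h1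

theorem squarefree_of_no_double_root {p : ℂ[X]}
    (h : ∀ z : ℂ, p.eval z = 0 → p.derivative.eval z = 0 → False) : Squarefree p := by
  refine Separable.squarefree ?_
  rw [separable_def, isCoprime_iff_aeval_ne_zero_of_isAlgClosed ℂ ℂ]
  intro z
  by_contra! hz
  exact h z (by simpa using hz.1) (by simpa using hz.2)

/-- For `n ≥ 10` the polynomial `N_n` has only simple complex roots, and for `m ≥ 4` the
polynomial `Q_m` has only simple complex roots. -/
theorem Nn_Qm_squarefree :
    (∀ n : ℕ, 10 ≤ n → Squarefree ((Nn n).map (Int.castRingHom ℂ))) ∧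
    (∀ m : ℕ, 4 ≤ m → Squarefree ((Qm m).map (Int.castRingHom ℂ))) := by
  constructor
  · intro n hn
    obtain ⟨k, rfl⟩ : ∃ k, n = k + 1 + 2 := ⟨n - 3, by omega⟩
    refine squarefree_of_no_double_root fun z h0 h1 => ?_
    simp [Nn] at h0 h1
    refine no_double_root (z := z) (ε := 1) (k := k) (by simp) (fun _ => by omega) ?_ ?_
    · linear_combination h0
    · linear_combination h1
  · intro m hm
    obtain ⟨k, rfl⟩ : ∃ k, m = k + 1 + 3 := ⟨m - 4, by omega⟩
    refine squarefree_of_no_double_root fun z h0 h1 => ?_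
    simp [Qm] at h0 h1
    have h0' : z ^ (k + 1) * (z ^ 3 - z - 1) + (-1) * (z ^ 3 + z ^ 2 - 1) = 0 := by
      linear_combination h0
    have h1' : (k + 1) * z ^ k * (z ^ 3 - z - 1) + z ^ (k + 1) * (3 * z ^ 2 - 1)
        + (-1) * (3 * z ^ 2 + 2 * z) = 0 := by
      linear_combination h1
    rcases lt_or_ge k 7 with hk | hk
    · exact no_double_root_of_lt_seven hk h0' h1'
    · exact no_double_root (by simp) (fun _ => by omega) h0' h1'
end

section
/- For every prime number p > 3, there exists a monic irreducible polynomial T ∈ ℤ[X] of degree p whose constant term is 1 or −1 and all of whose complex roots are real and lie in the open interval (−2.08, 2.08). -/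
open Polynomial

/-- A polynomial whose values alternate in sign along a decreasing list of points, one more
than its degree, splits with one root in each gap. -/
theorem exists_roots_of_alternating {F : ℤ[X]} (hF : F.Monic) {n : ℕ} (hn : F.natDegree = n)
    {a : ℕ → ℝ} (ha : ∀ i < n, a (i + 1) < a i)
    (hs : ∀ i ≤ n, 0 < (-1) ^ i * aeval (a i) F) :
    ∃ z : ℕ → ℝ, (∀ i < n, a (i + 1) < z i ∧ z i < a i) ∧
      F.map (algebraMap ℤ ℝ) = ∏ i ∈ Finset.range n, (X - C (z i)) := by
  have hcont : Continuous fun t : ℝ => aeval t F := F.continuous_aeval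
  have hex : ∀ i, ∃ z, i < n → (a (i + 1) < z ∧ z < a i) ∧ aeval z F = 0 := by
    intro i
    by_cases hi : i < n
    · have h1 := hs i hi.le
      have h2 := hs (i + 1) hi
      rw [pow_succ] at h2
      rcases neg_one_pow_eq_or ℝ i with h | h <;> rw [h] at h1 h2
      · obtain ⟨z, hz, hz0⟩ := intermediate_value_Ioo (ha i hi).le hcont.continuousOn
          (show (0 : ℝ) ∈ Set.Ioo _ _ from ⟨by linarith, by linarith⟩)
        exact ⟨z, fun _ => ⟨hz, hz0⟩⟩
      · obtain ⟨z, hz, hz0⟩ := intermediate_value_Ioo' (ha i hi).le hcont.continuousOn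
          (show (0 : ℝ) ∈ Set.Ioo _ _ from ⟨by linarith, by linarith⟩)
        exact ⟨z, fun _ => ⟨hz, hz0⟩⟩
    · exact ⟨0, fun h => absurd h hi⟩
  choose z hz using hex
  refine ⟨z, fun i hi => (hz i hi).1, ?_⟩
  have hanti : ∀ j < n, ∀ i < j, z j < z i := by
    intro j hj i hij
    have key : ∀ k, i + 1 ≤ k → k ≤ n → a k ≤ a (i + 1) := by
      intro k hk
      induction k, hk using Nat.le_induction with
      | base => intro _; exact le_rfl
      | succ k hk ih => intro hkn; exact (ha k (by omega)).le.trans (ih (by omega))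
    have h1 := (hz j hj).1.2
    have h2 := (hz i (hij.trans hj)).1.1
    have h3 := key j hij hj.le
    linarith
  have hinj : Set.InjOn z (Finset.range n) := by
    intro i hi j hj hij
    simp only [Finset.coe_range, Set.mem_Iio] at hi hj
    rcases lt_trichotomy i j with h | h | h
    · have := hanti j hj i h; linarith
    · exact h
    · have := hanti i hi j h; linarith
  have hmon : (F.map (algebraMap ℤ ℝ)).Monic := hF.map _
  have hdvd : ∏ i ∈ Finset.range n, (X - C (z i)) ∣ F.map (algebraMap ℤ ℝ) := by
    refine Finset.prod_dvd_of_coprime (fun i hi j hj hij => ?_) (fun i hi => ?_)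
    · exact isCoprime_X_sub_C_of_isUnit_sub
        (sub_ne_zero.2 fun h => hij (hinj hi hj h)).isUnit
    · rw [dvd_iff_isRoot, IsRoot, eval_map_algebraMap]
      exact (hz i (Finset.mem_range.1 hi)).2
  refine (eq_of_monic_of_dvd_of_natDegree_le
    (monic_prod_of_monic _ _ fun i _ => monic_X_sub_C _) hmon hdvd ?_)
  rw [natDegree_prod_of_monic _ _ fun i _ => monic_X_sub_C _, hF.natDegree_map, hn]
  simp

theorem norm_eq_one_of_add_inv_eq {y : ℂ} (hy : y ≠ 0) {r : ℝ} (h1 : -2 < r) (h2 : r < 2)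
    (h : y + y⁻¹ = r) : ‖y‖ = 1 := by
  have hq : y * y + 1 = r * y := by
    rw [← h]; field_simp
  have hre := congrArg Complex.re hq
  have him := congrArg Complex.im hq
  simp at hre him
  have hb : y.im ≠ 0 := by
    intro hb
    rw [hb] at hre
    nlinarith [sq_nonneg (2 * y.re - r)]
  have hr : r = 2 * y.re := by
    apply mul_right_cancel₀ hb
    linarith
  have : Complex.normSq y = 1 := by
    rw [Complex.normSq_apply]; rw [hr] at hre; nlinarith
  rw [Complex.norm_def, this, Real.sqrt_one]

/-- Kronecker's theorem for polynomials all of whose roots lie in `(-2, 2)`. -/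
theorem exists_rootOfUnity_of_roots_lt_two {A : ℤ[X]} (hA : A.Monic) (hdeg : A.natDegree ≠ 0)
    (hroots : ∀ w : ℂ, aeval w A = 0 → ∃ r : ℝ, -2 < r ∧ r < 2 ∧ w = r) :
    ∃ (x : ℂ) (n : ℕ), 0 < n ∧ x ^ n = 1 ∧ x ^ 2 ≠ 1 ∧ aeval (x + x⁻¹) A = 0 := by
  obtain ⟨α, hα⟩ : ∃ α : ℂ, aeval α A = 0 := by
    obtain ⟨α, hα⟩ := Complex.exists_root (f := A.map (algebraMap ℤ ℂ)) (by
      rw [hA.degree_map, degree_eq_natDegree hA.ne_zero]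
      exact_mod_cast Nat.pos_of_ne_zero hdeg)
    exact ⟨α, by rwa [IsRoot, eval_map_algebraMap] at hα⟩
  obtain ⟨x, hx⟩ : ∃ x : ℂ, x * x - α * x + 1 = 0 := by
    obtain ⟨s, hs⟩ := IsAlgClosed.exists_pow_nat_eq (α ^ 2 - 4) (n := 2) (by norm_num)
    exact ⟨(α + s) / 2, by linear_combination hs / 4⟩
  have hx0 : x ≠ 0 := by rintro rfl; simp at hx
  have hxα : x + x⁻¹ = α := by field_simp; linear_combination hx
  have hxint : IsIntegral ℤ x := by
    have hαi : IsIntegral ℤ α := ⟨A, hA, hα⟩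
    let β : integralClosure ℤ ℂ := ⟨α, hαi⟩
    refine isIntegral_trans (A := integralClosure ℤ ℂ) x
      ⟨X ^ 2 + (C (-β) * X + 1), ?_, ?_⟩
    · monicity!
    · have : algebraMap (integralClosure ℤ ℂ) ℂ β = α := rfl
      simp only [eval₂_add, eval₂_pow, eval₂_X, eval₂_mul, eval₂_C, eval₂_one, C_neg, eval₂_neg, this]
      linear_combination hx
  have hxQ : IsIntegral ℚ x := hxint.tower_top
  let K := IntermediateField.adjoin ℚ {x}
  have : FiniteDimensional ℚ K := IntermediateField.adjoin.finiteDimensional hxQ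
  have : NumberField K := { to_charZero := inferInstance, to_finiteDimensional := inferInstance }
  let y : K := IntermediateField.AdjoinSimple.gen ℚ x
  have hyx : algebraMap K ℂ y = x := IntermediateField.AdjoinSimple.algebraMap_gen ℚ x
  have hinj : Function.Injective (algebraMap K ℂ) := (algebraMap K ℂ).injective
  have hy0 : y ≠ 0 := by
    intro h; apply hx0; rw [← hyx, h, map_zero]
  have hyint : IsIntegral ℤ y := by
    rw [← isIntegral_algebraMap_iff hinj, hyx]; exact hxint
  have hyA : aeval (y + y⁻¹) A = 0 := by
    apply hinj
    rw [← aeval_algebraMap_apply, map_add, map_inv₀, hyx, hxα, hα, map_zero]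
  obtain ⟨n, hn, hyn⟩ := NumberField.Embeddings.pow_eq_one_of_norm_eq_one K ℂ hyint (by
    intro φ
    have h1 : aeval (φ y + (φ y)⁻¹) A = 0 := by
      have : aeval (φ (y + y⁻¹)) A = φ (aeval (y + y⁻¹) A) :=
        aeval_algHom_apply φ.toIntAlgHom _ _
      rwa [hyA, map_zero, map_add, map_inv₀] at this
    obtain ⟨r, hr1, hr2, hr⟩ := hroots _ h1
    exact norm_eq_one_of_add_inv_eq (by simpa using hy0) hr1 hr2 hr)
  refine ⟨x, n, hn, by rw [← hyx, ← map_pow, hyn, map_one], ?_, by rw [hxα, hα]⟩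
  intro hx2
  obtain ⟨r, hr1, hr2, hr⟩ := hroots _ hα
  rw [← hxα] at hr
  rcases sq_eq_sq_iff_eq_or_eq_neg.1 (hx2.trans (one_pow 2).symm) with h | h <;> rw [h] at hr
  all_goals
    have := congrArg Complex.re hr
    norm_num at this
    linarith

theorem irreducible_of_alternating {T F : ℤ[X]} (hT : T.Monic) (hTdeg : T.natDegree ≠ 0)
    (hTF : T ∣ F) (hF : F.Monic) {n : ℕ} (hn : F.natDegree = n) {a : ℕ → ℝ}
    (ha : ∀ i < n, a (i + 1) < a i) (hs : ∀ i ≤ n, 0 < (-1) ^ i * aeval (a i) F)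
    (ha0 : a 0 = 2.08) (ha1 : ∀ i ≤ n, 1 ≤ i → a i ≤ 2) (han : ∀ i ≤ n, -2 ≤ a i)
    (hcyc : ∀ (x : ℂ) (k : ℕ), 0 < k → x ^ k = 1 → x ^ 2 ≠ 1 → aeval (x + x⁻¹) T ≠ 0) :
    Irreducible T ∧ ∀ z : ℂ, aeval z T = 0 → z.im = 0 ∧ -2.08 < z.re ∧ z.re < 2.08 := by
  obtain ⟨z, hz, hprod⟩ := exists_roots_of_alternating hF hn ha hs
  have hprodC : F.map (algebraMap ℤ ℂ) = ∏ i ∈ Finset.range n, (X - C (z i : ℂ)) := by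
    have := congrArg (Polynomial.map (algebraMap ℝ ℂ)) hprod
    rw [Polynomial.map_map, Polynomial.map_prod, ← IsScalarTower.algebraMap_eq] at this
    simpa only [Polynomial.map_sub, map_X, map_C, Complex.coe_algebraMap] using this
  have hroot : ∀ w : ℂ, aeval w F = 0 → ∃ i < n, w = z i := by
    intro w hw
    rw [← eval_map_algebraMap, hprodC, eval_prod, Finset.prod_eq_zero_iff] at hw
    obtain ⟨i, hi, h⟩ := hw
    exact ⟨i, Finset.mem_range.1 hi, by simpa [sub_eq_zero] using h⟩
  have hdvd0 : ∀ {A B : ℤ[X]} {w : ℂ}, A ∣ B → aeval w A = 0 → aeval w B = 0 := by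
    rintro A _ w ⟨D, rfl⟩ h
    rw [map_mul, h, zero_mul]
  have hz2 : ∀ i < n, 1 ≤ i → -2 < z i ∧ z i < 2 := fun i hi h1 =>
    ⟨(han (i + 1) hi).trans_lt (hz i hi).1, (hz i hi).2.trans_le (ha1 i hi.le h1)⟩
  have hbig : ∀ A : ℤ[X], A.Monic → A.natDegree ≠ 0 → A ∣ T → aeval (z 0 : ℂ) A = 0 := by
    intro A hA hdeg hAT
    by_contra h0
    obtain ⟨x, k, hk, hxk, hx2, hxA⟩ := exists_rootOfUnity_of_roots_lt_two hA hdeg (by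
      intro w hw
      obtain ⟨i, hi, rfl⟩ := hroot w (hdvd0 (hAT.trans hTF) hw)
      have hi0 : i ≠ 0 := by rintro rfl; exact h0 hw
      exact ⟨z i, (hz2 i hi (by omega)).1, (hz2 i hi (by omega)).2, rfl⟩)
    exact hcyc x k hk hxk hx2 (hdvd0 hAT hxA)
  refine ⟨?_, ?_⟩
  · rw [hT.irreducible_iff_natDegree]
    refine ⟨fun h => hTdeg (by simp [h]), fun f g hf hg hfg => ?_⟩
    by_contra! hcon
    have h1 := hbig f hf hcon.1 ⟨g, hfg.symm⟩
    have h2 := hbig g hg hcon.2 ⟨f, by rw [← hfg, mul_comm]⟩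
    rw [← eval_map_algebraMap] at h1 h2
    have h3 : (X - C (z 0 : ℂ)) * (X - C (z 0 : ℂ)) ∣ F.map (algebraMap ℤ ℂ) := by
      refine (mul_dvd_mul (dvd_iff_isRoot.2 h1) (dvd_iff_isRoot.2 h2)).trans ?_
      rw [← Polynomial.map_mul, hfg]
      exact Polynomial.map_dvd _ hTF
    have hn0 : n ≠ 0 := by
      rintro rfl
      have := natDegree_le_of_dvd hTF hF.ne_zero
      omega
    obtain ⟨d, rfl⟩ := Nat.exists_eq_succ_of_ne_zero hn0
    rw [hprodC, Finset.prod_range_succ', mul_comm (∏ i ∈ _, _),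
      mul_dvd_mul_iff_left (X_sub_C_ne_zero _), dvd_iff_isRoot, IsRoot, eval_prod,
      Finset.prod_eq_zero_iff] at h3
    obtain ⟨i, hi, h⟩ := h3
    have hi := Finset.mem_range.1 hi
    have h4 : z 0 = z (i + 1) := by
      have : (z 0 : ℂ) = z (i + 1) := by simpa [sub_eq_zero] using h
      exact_mod_cast this
    have h5 : a (i + 1) ≤ a 1 := by
      have key : ∀ j, 1 ≤ j → j ≤ d + 1 → a j ≤ a 1 := by
        intro k hk
        induction k, hk using Nat.le_induction with
        | base => intro _; exact le_rfl
        | succ k hk ih => intro hkn; exact (ha k (by omega)).le.trans (ih (by omega))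
      exact key _ (by omega) (by omega)
    have h6 := (hz (i + 1) (by omega)).2
    have h7 := (hz 0 (by omega)).1
    norm_num at h7
    linarith
  · intro w hw
    obtain ⟨i, hi, rfl⟩ := hroot w (hdvd0 hTF hw)
    refine ⟨Complex.ofReal_im _, ?_, ?_⟩ <;> rw [Complex.ofReal_re]
    · have := (hz i hi).1
      have := han (i + 1) hi
      norm_num; linarith
    · rcases Nat.eq_zero_or_pos i with rfl | h
      · exact ha0 ▸ (hz 0 hi).2
      · have := (hz2 i hi h).2
        norm_num; linarith

theorem IsPrimitiveRoot.aeval_pow_eq_zero {f : ℤ[X]} {x : ℂ} {m i : ℕ} (hx : IsPrimitiveRoot x m)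
    (hm : 0 < m) (hi : i.Coprime m) (hf : aeval x f = 0) : aeval (x ^ i) f = 0 := by
  have h1 : cyclotomic m ℤ ∣ f := by
    rw [cyclotomic_eq_minpoly hx hm]
    exact minpoly.isIntegrallyClosed_dvd (hx.isIntegral hm) hf
  obtain ⟨g, rfl⟩ := h1
  have h2 := (hx.pow_of_coprime i hi).isRoot_cyclotomic hm
  rw [IsRoot, ← map_cyclotomic_int, eval_map] at h2
  rw [map_mul, aeval_def, algebraMap_int_eq, h2, zero_mul]

/-- Every root of unity is conjugate to its opposite, its square, or the opposite of its square. -/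
theorem IsPrimitiveRoot.aeval_neg_or_sq {f : ℤ[X]} {x : ℂ} {m : ℕ} (hx : IsPrimitiveRoot x m)
    (hm : 0 < m) (hf : aeval x f = 0) :
    aeval (-x) f = 0 ∨ (Odd m ∧ aeval (x ^ 2) f = 0) ∨ aeval (-x ^ 2) f = 0 := by
  rcases Nat.even_or_odd' m with ⟨k, rfl | rfl⟩
  · have hk : x ^ k = -1 := by
      have h1 : (x ^ k) ^ 2 = 1 ^ 2 := by rw [← pow_mul, mul_comm, hx.pow_eq_one, one_pow]
      have h2 : x ^ k ≠ 1 := hx.pow_ne_one_of_pos_of_lt (by omega) (by omega)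
      exact (sq_eq_sq_iff_eq_or_eq_neg.1 h1).resolve_left h2
    rcases Nat.even_or_odd' k with ⟨j, rfl | rfl⟩
    · left
      have := hx.aeval_pow_eq_zero (i := 2 * j + 1) hm (by
        rw [Nat.coprime_mul_iff_right, Nat.coprime_mul_iff_right]
        simp) hf
      rwa [pow_succ, hk, neg_one_mul] at this
    · right; right
      have := hx.aeval_pow_eq_zero (i := (2 * j + 1) + 2) hm (by
        rw [Nat.coprime_mul_iff_right, Nat.coprime_self_add_left]
        simp [Nat.odd_add, parity_simps]) hf
      rwa [pow_add, hk, neg_one_mul] at this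
  · right; left
    exact ⟨⟨k, rfl⟩, hx.aeval_pow_eq_zero hm (by simp) hf⟩

theorem lehmer_ne_zero {x : ℂ} {m : ℕ} (hx : IsPrimitiveRoot x m) (hm : Odd m) :
    x ^ 10 + x ^ 9 - x ^ 7 - x ^ 6 - x ^ 5 - x ^ 4 - x ^ 3 + x + 1 ≠ 0 := by
  intro h
  have hx0 : x ≠ 0 := hx.ne_zero hm.pos.ne'
  let f : ℤ[X] := X ^ 10 + X ^ 9 - X ^ 7 - X ^ 6 - X ^ 5 - X ^ 4 - X ^ 3 + X + 1
  have h2 := hx.aeval_pow_eq_zero (f := f) (i := 2) hm.pos (by simpa using hm) (by simpa [f] using h)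
  simp only [f, map_add, map_sub, map_pow, aeval_X, map_one] at h2
  set t := x + x⁻¹ with ht
  have e1 : t ^ 5 + t ^ 4 - 5 * t ^ 3 - 5 * t ^ 2 + 4 * t + 3 = 0 := by
    rw [ht]; field_simp; linear_combination h
  set u := t ^ 2 - 2 with hu
  have e2 : u ^ 5 + u ^ 4 - 5 * u ^ 3 - 5 * u ^ 2 + 4 * u + 3 = 0 := by
    have : u = x ^ 2 + (x ^ 2)⁻¹ := by rw [hu, ht]; field_simp; ring
    rw [this]; field_simp; linear_combination h2
  have : (2 : ℂ) = 0 := by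
    rw [hu] at e2
    linear_combination (2 - 4 * t - 9 * t ^ 2 + 25 * t ^ 3 + 6 * t ^ 4 - 26 * t ^ 5 - t ^ 6
      + 9 * t ^ 7 - t ^ 9) * e1 + (4 - 4 * t - 5 * t ^ 2 + t ^ 3 + t ^ 4) * e2
  norm_num at this

theorem plastic_relation_conj {n : ℕ} {s : ℤ} {x : ℂ} {m : ℕ} (hx : IsPrimitiveRoot x m)
    (hm : 0 < m) (h : x ^ n * (x ^ 3 - x - 1) = s * (x ^ 3 + x ^ 2 - 1)) :
    (-x) ^ n * (-x ^ 3 + x - 1) = s * (-x ^ 3 + x ^ 2 - 1) ∨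
    (Odd m ∧ (x ^ n) ^ 2 * (x ^ 6 - x ^ 2 - 1) = s * (x ^ 6 + x ^ 4 - 1)) ∨
    (-1) ^ n * (x ^ n) ^ 2 * (-x ^ 6 + x ^ 2 - 1) = s * (-x ^ 6 + x ^ 4 - 1) := by
  let f : ℤ[X] := X ^ n * (X ^ 3 - X - 1) - C s * (X ^ 3 + X ^ 2 - 1)
  have hf : ∀ y : ℂ, aeval y f = y ^ n * (y ^ 3 - y - 1) - s * (y ^ 3 + y ^ 2 - 1) := by
    intro y; simp [f]
  rcases hx.aeval_neg_or_sq (f := f) hm (by rw [hf, h, sub_self]) with h1 | ⟨h0, h1⟩ | h1 <;>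
    rw [hf] at h1
  · left; linear_combination h1
  · right; left; exact ⟨h0, by rw [← pow_mul, mul_comm n, pow_mul]; linear_combination h1⟩
  · right; right
    rw [neg_pow (x ^ 2) n, ← pow_mul, mul_comm 2, pow_mul] at h1
    linear_combination h1

theorem plastic_ne_zero {w s x : ℂ} (hs : s ≠ 0)
    (h : w * (x ^ 3 - x - 1) = s * (x ^ 3 + x ^ 2 - 1)) : x ^ 3 - x - 1 ≠ 0 := by
  intro hP
  rw [hP, mul_zero] at h
  have hQ : x ^ 3 + x ^ 2 - 1 = 0 := by simpa [hs] using h.symm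
  have h1 : x * (x + 1) = 0 := by linear_combination hQ - hP
  rcases mul_eq_zero.1 h1 with h0 | h0
  · rw [h0] at hP; norm_num at hP
  · rw [eq_neg_of_add_eq_zero_left h0] at hP; norm_num at hP

theorem plastic_cube_ne {x : ℂ} (h : x ^ 6 - x ^ 3 + 1 = 0) :
    (x ^ 3 - x - 1) ^ 3 ≠ (x ^ 3 + x ^ 2 - 1) ^ 3 := by
  intro h1
  have : (3 : ℂ) = 0 := by
    linear_combination (8 - 15 * x + 15 * x ^ 2 - 16 * x ^ 3 + 12 * x ^ 4 - 3 * x ^ 5) * h1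
      + (3 + 24 * x + 3 * x ^ 2 - 34 * x ^ 3 - 21 * x ^ 4 + 21 * x ^ 5 + 18 * x ^ 6 - 9 * x ^ 7) * h
  norm_num at this

theorem plastic_relation_false_of_twelve_dvd {n k : ℕ} {x : ℂ} (hk : 0 < k) (hxk : x ^ k = 1)
    (hx2 : x ^ 2 ≠ 1) (hn : 12 ∣ n) : x ^ n * (x ^ 3 - x - 1) ≠ x ^ 3 + x ^ 2 - 1 := by
  intro h
  have hx0 : x ≠ 0 := by rintro rfl; simp [hk.ne'] at hxk
  have hm : 0 < orderOf x := orderOf_pos_iff.2 (isOfFinOrder_iff_pow_eq_one.2 ⟨k, hk, hxk⟩)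
  have hx := IsPrimitiveRoot.orderOf x
  have hx1 : x + 1 ≠ 0 := fun h0 => hx2 (by rw [eq_neg_of_add_eq_zero_left h0]; norm_num)
  have hx1' : x - 1 ≠ 0 := fun h0 => hx2 (by rw [sub_eq_zero.1 h0]; norm_num)
  have hne : Even n := even_iff_two_dvd.2 (dvd_trans (by norm_num) hn)
  obtain ⟨d, hd⟩ := hn
  rcases plastic_relation_conj (n := n) (s := 1) hx hm (by simpa using h) with h1 | ⟨ho, h1⟩ | h1
  · rw [hne.neg_pow] at h1
    have h2 : x ^ 4 - x ^ 2 + 1 = 0 := by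
      have : x * (x ^ 4 - x ^ 2 + 1) = 0 := by
        push_cast at h1
        linear_combination -(x ^ 3 - x - 1) / 2 * h1 + (-x ^ 3 + x - 1) / 2 * h
      simpa [hx0] using this
    have h12 : x ^ 12 = 1 := by linear_combination (x^2+1) * (x ^ 6 - 1) * h2
    rw [hd, pow_mul, h12, one_pow] at h
    have : x * (x + 1) = 0 := by linear_combination -h
    simp [hx0, hx1] at this
  · apply lehmer_ne_zero hx ho
    have : 2 * x * (x ^ 10 + x ^ 9 - x ^ 7 - x ^ 6 - x ^ 5 - x ^ 4 - x ^ 3 + x + 1) = 0 := by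
      push_cast at h1
      linear_combination -(x ^ 6 - x ^ 2 - 1) * ((x ^ 3 + x ^ 2 - 1) + x ^ n * (x ^ 3 - x - 1)) * h
        + (x ^ 3 - x - 1) ^ 2 * h1
    simpa [hx0] using this
  · rw [hne.neg_one_pow] at h1
    have h2 : x ^ 6 - x ^ 3 + 1 = 0 := by
      have : 2 * x * (x - 1) * (x + 1) ^ 3 * (x ^ 6 - x ^ 3 + 1) = 0 := by
        push_cast at h1
        linear_combination (-x ^ 6 + x ^ 2 - 1) * ((x ^ 3 + x ^ 2 - 1) + x ^ n * (x ^ 3 - x - 1)) * h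
          - (x ^ 3 - x - 1) ^ 2 * h1
      simpa [hx0, hx1, hx1'] using this
    have h18 : x ^ 18 = 1 := by linear_combination (x^3+1) * (x ^ 9 - 1) * h2
    apply plastic_cube_ne h2
    rw [← h, mul_pow, ← pow_mul, hd, show 12 * d * 3 = 18 * (2 * d) by ring, pow_mul, h18, one_pow,
      one_mul]

theorem plastic_relation_neg_false {n k : ℕ} {x : ℂ} (hk : 0 < k)
    (hxk : x ^ k = 1) (hx2 : x ^ 2 ≠ 1) (hn : n % 12 = 9) (hn5 : n % 5 ≠ 2) :
    x ^ n * (x ^ 3 - x - 1) ≠ -(x ^ 3 + x ^ 2 - 1) := by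
  intro h
  have hx0 : x ≠ 0 := by rintro rfl; simp [hk.ne'] at hxk
  have hm : 0 < orderOf x := orderOf_pos_iff.2 (isOfFinOrder_iff_pow_eq_one.2 ⟨k, hk, hxk⟩)
  have hx := IsPrimitiveRoot.orderOf x
  have hx1 : x + 1 ≠ 0 := fun h0 => hx2 (by rw [eq_neg_of_add_eq_zero_left h0]; norm_num)
  have hx1' : x - 1 ≠ 0 := fun h0 => hx2 (by rw [sub_eq_zero.1 h0]; norm_num)
  have hP := plastic_ne_zero (s := -1) (by norm_num) (by rw [h]; ring)
  have hno : Odd n := Nat.odd_iff.2 (by omega)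
  have hmod : ∀ {m : ℕ}, x ^ m = 1 → x ^ n = x ^ (n % m) := fun hxm => pow_eq_pow_mod n hxm
  rcases plastic_relation_conj (n := n) (s := -1) hx hm (by rw [h]; push_cast; ring) with
    h1 | ⟨-, h1⟩ | h1
  · rw [hno.neg_pow] at h1
    have h2 : x ^ 4 + 1 = 0 := by
      have : 2 * (x - 1) * (x + 1) * (x ^ 4 + 1) = 0 := by
        push_cast at h1
        linear_combination -(-x ^ 3 + x - 1) * h - (x ^ 3 - x - 1) * h1
      simpa [hx1, hx1'] using this
    have h8 : x ^ 8 = 1 := by linear_combination (x ^ 4 - 1) * h2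
    have hw : (x ^ n) ^ 2 = x ^ 2 := by
      rw [← pow_mul, pow_eq_pow_mod (n * 2) h8, show n * 2 % 8 = 2 by omega]
    have : 2 * x ^ 2 * (x ^ 3 - x - 1) ^ 2 = 0 := by
      linear_combination -((x ^ 3 + x ^ 2 - 1) - x ^ n * (x ^ 3 - x - 1)) * h
        - (x ^ 3 - x - 1) ^ 2 * hw + (x ^ 2 * (x ^ 3 - x - 1) ^ 2
        + ((x ^ 3 + x ^ 2 - 1) - x ^ 3 * (x ^ 3 - x - 1)) * (x ^ 2 - 1)) * h2
    simp [hx0, hP] at this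
  · have : 2 * (x - 1) ^ 3 * (x + 1) * (x ^ 2 + x + 1) ^ 2 * (x ^ 4 + x ^ 3 + x ^ 2 + x + 1) = 0 := by
      push_cast at h1
      linear_combination (x ^ 6 - x ^ 2 - 1) * ((x ^ 3 + x ^ 2 - 1) - x ^ n * (x ^ 3 - x - 1)) * h
        + (x ^ 3 - x - 1) ^ 2 * h1
    have : x ^ 2 + x + 1 = 0 ∨ x ^ 4 + x ^ 3 + x ^ 2 + x + 1 = 0 := by
      simpa [hx1, hx1'] using this
    rcases this with h2 | h2
    · have h3 : x ^ 3 = 1 := by linear_combination (x - 1) * h2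
      rw [hmod h3, show n % 3 = 0 by omega, pow_zero] at h
      have : x * (x - 1) = 0 := by linear_combination h - 2 * h3
      simp [hx0, hx1'] at this
    · have h5 : x ^ 5 = 1 := by linear_combination (x - 1) * h2
      have hw : x ^ n = x ^ 2 := by
        apply mul_right_cancel₀ hP
        linear_combination h - h5
      rw [hmod h5] at hw
      have h5n : n % 5 < 5 := Nat.mod_lt _ (by norm_num)
      interval_cases n % 5
      · exact hx2 (by linear_combination -hw)
      · have : x * (x - 1) = 0 := by linear_combination -hw
        simp [hx0, hx1'] at this
      · exact hn5 rfl
      · have : x ^ 2 * (x - 1) = 0 := by linear_combination hw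
        simp [hx0, hx1'] at this
      · have : x ^ 2 * (x - 1) * (x + 1) = 0 := by linear_combination hw
        simp [hx0, hx1, hx1'] at this
  · rw [hno.neg_one_pow] at h1
    have h2 : x ^ 6 - x ^ 3 + 1 = 0 := by
      have : 2 * x * (x - 1) * (x + 1) ^ 3 * (x ^ 6 - x ^ 3 + 1) = 0 := by
        push_cast at h1
        linear_combination -(-x ^ 6 + x ^ 2 - 1) * ((x ^ 3 + x ^ 2 - 1) - x ^ n * (x ^ 3 - x - 1)) * h
          + (x ^ 3 - x - 1) ^ 2 * h1
      simpa [hx0, hx1, hx1'] using this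
    have h9 : x ^ 9 = -1 := by linear_combination (x ^ 3 + 1) * h2
    have h18 : x ^ 18 = 1 := by linear_combination (x ^ 9 - 1) * h9
    have hw : (x ^ n) ^ 3 = -1 := by
      rw [← pow_mul, pow_eq_pow_mod (n * 3) h18, show n * 3 % 18 = 9 by omega, h9]
    apply plastic_cube_ne h2
    have h3 : (x ^ n * (x ^ 3 - x - 1)) ^ 3 = (-(x ^ 3 + x ^ 2 - 1)) ^ 3 := by rw [h]
    rw [mul_pow, hw] at h3
    linear_combination -h3

theorem cube_eq_one_of_plastic_relation_neg {n k : ℕ} {x : ℂ} (hk : 0 < k)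
    (hxk : x ^ k = 1) (hx2 : x ^ 2 ≠ 1) (hn : n % 60 = 58)
    (h : x ^ n * (x ^ 3 - x - 1) = -(x ^ 3 + x ^ 2 - 1)) :
    x ^ 3 = 1 := by
  have hx0 : x ≠ 0 := by rintro rfl; simp [hk.ne'] at hxk
  have hm : 0 < orderOf x := orderOf_pos_iff.2 (isOfFinOrder_iff_pow_eq_one.2 ⟨k, hk, hxk⟩)
  have hx := IsPrimitiveRoot.orderOf x
  have hx1 : x + 1 ≠ 0 := fun h0 => hx2 (by rw [eq_neg_of_add_eq_zero_left h0]; norm_num)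
  have hx1' : x - 1 ≠ 0 := fun h0 => hx2 (by rw [sub_eq_zero.1 h0]; norm_num)
  have hne : Even n := Nat.even_iff.2 (by omega)
  have h60 : x ^ 60 = 1 := by
    rcases plastic_relation_conj (n := n) (s := -1) hx hm (by rw [h]; push_cast; ring) with
      h1 | ⟨-, h1⟩ | h1
    · rw [hne.neg_pow] at h1
      have h2 : x ^ 4 - x ^ 2 + 1 = 0 := by
        have : x * (x ^ 4 - x ^ 2 + 1) = 0 := by
          push_cast at h1
          linear_combination (x ^ 3 - x - 1) / 2 * h1 - (-x ^ 3 + x - 1) / 2 * h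
        simpa [hx0] using this
      have h12 : x ^ 12 = 1 := by linear_combination (x ^ 2 + 1) * (x ^ 6 - 1) * h2
      rw [show 60 = 12 * 5 by norm_num, pow_mul, h12, one_pow]
    · have : 2 * (x - 1) ^ 3 * (x + 1) * (x ^ 2 + x + 1) ^ 2 * (x ^ 4 + x ^ 3 + x ^ 2 + x + 1)
          = 0 := by
        push_cast at h1
        linear_combination (x ^ 6 - x ^ 2 - 1) * ((x ^ 3 + x ^ 2 - 1) - x ^ n * (x ^ 3 - x - 1)) * h
          + (x ^ 3 - x - 1) ^ 2 * h1
      have : x ^ 2 + x + 1 = 0 ∨ x ^ 4 + x ^ 3 + x ^ 2 + x + 1 = 0 := by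
        simpa [hx1, hx1'] using this
      rcases this with h2 | h2
      · have h3 : x ^ 3 = 1 := by linear_combination (x - 1) * h2
        rw [show 60 = 3 * 20 by norm_num, pow_mul, h3, one_pow]
      · have h5 : x ^ 5 = 1 := by linear_combination (x - 1) * h2
        rw [show 60 = 5 * 12 by norm_num, pow_mul, h5, one_pow]
    · rw [hne.neg_one_pow] at h1
      have : (x ^ 4 - x ^ 2 + 1) * (x ^ 8 + x ^ 7 - x ^ 5 - x ^ 4 - x ^ 3 + x + 1) = 0 := by
        push_cast at h1
        linear_combination -(-x ^ 6 + x ^ 2 - 1) * ((x ^ 3 + x ^ 2 - 1) - x ^ n * (x ^ 3 - x - 1)) / 2 * h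
          - (x ^ 3 - x - 1) ^ 2 / 2 * h1
      rcases mul_eq_zero.1 this with h2 | h2
      · have h12 : x ^ 12 = 1 := by linear_combination (x ^ 2 + 1) * (x ^ 6 - 1) * h2
        rw [show 60 = 12 * 5 by norm_num, pow_mul, h12, one_pow]
      · have h15 : x ^ 15 = -1 := by
          linear_combination (1 - x + x ^ 2 + x ^ 5 - x ^ 6 + x ^ 7) * h2
        rw [show 60 = 15 * 4 by norm_num, pow_mul, h15]
        norm_num
  have hw : x ^ n * x ^ 2 = 1 := by
    rw [← pow_add, pow_eq_pow_mod (n + 2) h60, show (n + 2) % 60 = 0 by omega, pow_zero]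
  have : (x - 1) * (x ^ 2 + x + 1) ^ 2 = 0 := by
    linear_combination x ^ 2 * h - (x ^ 3 - x - 1) * hw
  have h2 : x ^ 2 + x + 1 = 0 := by simpa [hx1'] using this
  linear_combination (x - 1) * h2

/-- The sequence of polynomials `a, b, q * b - a, …` with `f (k + 2) = q * f (k + 1) - f k`. -/
noncomputable def linRec (q a b : ℤ[X]) : ℕ → ℤ[X]
  | 0 => a
  | 1 => b
  | k + 2 => q * linRec q a b (k + 1) - linRec q a b k

theorem linRec_monic_natDegree {q a b : ℤ[X]} (hq : q.Monic) (hq0 : 0 < q.natDegree)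
    (ha : a.Monic) (hb : b.Monic) (hab : b.natDegree = a.natDegree + q.natDegree) (k : ℕ) :
    (linRec q a b k).Monic ∧
      (linRec q a b k).natDegree = a.natDegree + k * q.natDegree := by
  induction k using Nat.twoStepInduction with
  | zero => simp [linRec, ha]
  | one => simp [linRec, hb, hab]
  | more k ih0 ih1 =>
    have hm := hq.mul ih1.1
    have hd : (q * linRec q a b (k + 1)).natDegree = a.natDegree + (k + 2) * q.natDegree := by
      rw [hq.natDegree_mul ih1.1, ih1.2]; ring
    have hlt : (linRec q a b k).natDegree < (q * linRec q a b (k + 1)).natDegree := by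
      rw [hd, ih0.2]; nlinarith
    exact ⟨hm.sub_of_left (degree_lt_degree hlt),
      (natDegree_sub_eq_left_of_natDegree_lt hlt).trans hd⟩

theorem linRec_coeff_zero_of_odd {q a b : ℤ[X]} (hq : q.coeff 0 = 0)
    (hb : b.coeff 0 = 1 ∨ b.coeff 0 = -1) {k : ℕ} (hk : Odd k) :
    (linRec q a b k).coeff 0 = 1 ∨ (linRec q a b k).coeff 0 = -1 := by
  obtain ⟨m, rfl⟩ := hk
  induction m with
  | zero => exact hb
  | succ m ih =>
    have : (linRec q a b (2 * (m + 1) + 1)).coeff 0 = -(linRec q a b (2 * m + 1)).coeff 0 := by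
      simp [show 2 * (m + 1) + 1 = 2 * m + 1 + 2 by ring, linRec, mul_coeff_zero, hq]
    omega

theorem aeval_linRec {R : Type*} [CommRing R] (q a b : ℤ[X]) (x : R) (k : ℕ) :
    aeval x (linRec q a b (k + 2)) =
      aeval x q * aeval x (linRec q a b (k + 1)) - aeval x (linRec q a b k) := by
  simp [linRec]

theorem linRec_aeval_pos {a b : ℤ[X]} {m k : ℕ} (hmk : m ≤ k)
    (h0 : 0 < aeval (2.08 : ℝ) (linRec X a b m))
    (h1 : 0.755 * aeval (2.08 : ℝ) (linRec X a b m) ≤ aeval (2.08 : ℝ) (linRec X a b (m + 1))) :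
    0 < aeval (2.08 : ℝ) (linRec X a b k) := by
  suffices 0 < aeval (2.08 : ℝ) (linRec X a b k) ∧ 0.755 * aeval (2.08 : ℝ) (linRec X a b k) ≤
      aeval (2.08 : ℝ) (linRec X a b (k + 1)) from this.1
  induction k, hmk using Nat.le_induction with
  | base => exact ⟨h0, h1⟩
  | succ k _ ih =>
    rw [aeval_linRec, aeval_X]
    constructor <;> linarith

theorem linRec_aeval_add_inv {a b : ℤ[X]} {x u v w : ℂ} (hx : x ≠ 0)
    (h0 : aeval (x + x⁻¹) a * w = u - v) (h1 : aeval (x + x⁻¹) b * w * x = x ^ 2 * u - v) (k : ℕ) :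
    aeval (x + x⁻¹) (linRec X a b k) * w * x ^ k = x ^ (2 * k) * u - v := by
  induction k using Nat.twoStepInduction with
  | zero => simpa [linRec] using h0
  | one => simpa [linRec] using h1
  | more k ih0 ih1 =>
    have ht : (x + x⁻¹) * x = x ^ 2 + 1 := by field_simp
    rw [aeval_linRec, aeval_X]
    linear_combination (x ^ 2 + 1) * ih1 - x ^ 2 * ih0 +
      aeval (x + x⁻¹) (linRec X a b (k + 1)) * w * x ^ (k + 1) * ht

theorem linRec_aeval_two_mul_cos {a b : ℤ[X]} {φ α c s w : ℝ}
    (h0 : aeval (2 * Real.cos φ) a * w = c * Real.cos α + s * Real.sin α)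
    (h1 : aeval (2 * Real.cos φ) b * w = c * Real.cos (α + φ) + s * Real.sin (α + φ)) (k : ℕ) :
    aeval (2 * Real.cos φ) (linRec X a b k) * w =
      c * Real.cos (α + k * φ) + s * Real.sin (α + k * φ) := by
  induction k using Nat.twoStepInduction with
  | zero => simpa [linRec] using h0
  | one => simpa [linRec] using h1
  | more k ih0 ih1 =>
    have hα : α + k * φ = α + (k + 1 : ℕ) * φ - φ := by push_cast; ring
    have hα' : α + (k + 2 : ℕ) * φ = α + (k + 1 : ℕ) * φ + φ := by push_cast; ring
    rw [hα, Real.cos_sub, Real.sin_sub] at ih0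
    rw [aeval_linRec, aeval_X, hα', Real.cos_add _ φ, Real.sin_add _ φ]
    linear_combination 2 * Real.cos φ * ih1 - ih0

/-- A version of `irreducible_of_alternating` whose sample points are `2.08`, the numbers
`2 * cos (θ i)` and `-2`. -/
theorem irreducible_of_alternating_cos {T F : ℤ[X]} (hT : T.Monic) (hTdeg : T.natDegree ≠ 0)
    (hTF : T ∣ F) (hF : F.Monic) {n : ℕ} (hn : F.natDegree = n + 1) {θ : ℕ → ℝ}
    (hθ : StrictMono θ) (hθ0 : 0 ≤ θ 0) (hθ1 : ∀ i < n, θ i < Real.pi) (hθn : Real.pi ≤ θ n)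
    (h0 : 0 < aeval (2.08 : ℝ) F) (hs : ∀ i < n, (-1) ^ i * aeval (2 * Real.cos (θ i)) F < 0)
    (hsn : (-1) ^ n * aeval (-2 : ℝ) F < 0)
    (hcyc : ∀ (x : ℂ) (k : ℕ), 0 < k → x ^ k = 1 → x ^ 2 ≠ 1 → aeval (x + x⁻¹) T ≠ 0) :
    Irreducible T ∧ ∀ z : ℂ, aeval z T = 0 → z.im = 0 ∧ -2.08 < z.re ∧ z.re < 2.08 := by
  let a : ℕ → ℝ := fun i => Nat.casesOn i 2.08 fun j => 2 * Real.cos (min Real.pi (θ j))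
  have ha : ∀ i < n, a (i + 1) = 2 * Real.cos (θ i) := fun i hi => by
    simp only [a, min_eq_right (hθ1 i hi).le]
  have han : a (n + 1) = -2 := by simp [a, min_eq_left hθn]
  have hle : ∀ i, a (i + 1) ≤ 2 := fun i => by
    have := Real.cos_le_one (min Real.pi (θ i))
    simp only [a]; linarith
  have hge : ∀ i, -2 ≤ a i := fun i => by
    rcases i with _ | i
    · norm_num [a]
    · have := Real.neg_one_le_cos (min Real.pi (θ i))
      simp only [a]; linarith
  refine irreducible_of_alternating (a := a) hT hTdeg hTF hF hn ?_ ?_ rfl ?_ (fun i _ => hge i) hcyc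
  · rintro (_ | i) hi
    · exact (hle 0).trans_lt (by norm_num [a])
    · have h0i : 0 ≤ θ i := hθ0.trans (hθ.monotone (Nat.zero_le i))
      have := Real.cos_lt_cos_of_nonneg_of_le_pi (x := min Real.pi (θ i))
        (y := min Real.pi (θ (i + 1))) (le_min Real.pi_pos.le h0i) (min_le_left _ _)
        (by rw [min_eq_right (hθ1 i (by omega)).le]
            exact lt_min (hθ1 i (by omega)) (hθ i.lt_succ_self))
      simp only [a]; linarith
  · rintro (_ | i) hi
    · simpa [a] using h0
    · rw [pow_succ]
      rcases (Nat.le_of_succ_le_succ hi).lt_or_eq with h | rfl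
      · rw [ha i h]; linarith [hs i h]
      · rw [han]; linarith
  · rintro (_ | i) _ h1
    · omega
    · exact hle i

theorem linRec_aeval_neg_two {a b : ℤ[X]} {r s : ℝ} (ha : aeval (-2 : ℝ) a = r)
    (hb : aeval (-2 : ℝ) b = -(r + s)) (k : ℕ) :
    aeval (-2 : ℝ) (linRec X a b k) = (-1) ^ k * (r + k * s) := by
  induction k using Nat.twoStepInduction with
  | zero => simpa [linRec] using ha
  | one => simpa [linRec] using hb
  | more k ih0 ih1 =>
    rw [aeval_linRec, aeval_X, ih0, ih1]
    push_cast
    ring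

/-- The polynomials of degree `k + 2` used in degrees `p ≡ 1 [MOD 6]`. -/
noncomputable def plasticPolyOne : ℕ → ℤ[X] :=
  linRec X (X ^ 2 - X - 3) (X ^ 3 - X ^ 2 - 3 * X + 1)

/-- The polynomials of degree `k + 2` used in most degrees `p ≡ 5 [MOD 6]`. -/
noncomputable def plasticPolyFive : ℕ → ℤ[X] :=
  linRec X (X ^ 2 - 2) (X ^ 3 - 3 * X - 1)

/-- The polynomials of degree `k + 2` one of whose factors is used in degrees
`p ≡ 29 [MOD 30]`. -/
noncomputable def plasticPolyAux : ℕ → ℤ[X] :=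
  linRec X (X ^ 2 + X - 1) (X ^ 3 + X ^ 2 - 3 * X - 3)

theorem sin_three_mul_eq (u : ℝ) :
    Real.sin (3 * u) = Real.sin u * (4 * Real.cos u ^ 2 - 1) := by
  rw [Real.sin_three_mul]
  linear_combination -4 * Real.sin u * Real.sin_sq_add_cos_sq u

theorem plasticPolyOne_aeval_cos (u : ℝ) (k : ℕ) :
    aeval (2 * Real.cos (2 * u)) (plasticPolyOne k) * Real.cos u =
      -Real.cos u * Real.cos (2 * u + k * (2 * u)) +
        (-Real.sin u * (8 * Real.cos u ^ 2 - 1)) * Real.sin (2 * u + k * (2 * u)) := by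
  have h := Real.sin_sq_add_cos_sq u
  apply linRec_aeval_two_mul_cos
  · simp only [map_sub, map_pow, aeval_X, map_ofNat, Real.sin_two_mul, Real.cos_two_mul]
    linear_combination (-2 * Real.cos u * (1 - 8 * Real.cos u ^ 2)) * h
  · simp only [map_sub, map_add, map_mul, map_pow, aeval_X, map_one, map_ofNat, Real.cos_add,
      Real.sin_add, Real.sin_two_mul, Real.cos_two_mul]
    linear_combination (-4 * Real.cos u ^ 3 - 4 * Real.cos u * (2 * Real.cos u ^ 2 - 1) * (1 - 8 * Real.cos u ^ 2)) * h

theorem plasticPolyFive_aeval_cos (u : ℝ) (k : ℕ) :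
    aeval (2 * Real.cos (2 * u)) (plasticPolyFive k) * Real.sin (2 * u) =
      (Real.sin u * (8 * Real.cos u ^ 2 - 1)) * Real.cos (3 * u + k * (2 * u)) +
        (-Real.cos u) * Real.sin (3 * u + k * (2 * u)) := by
  have h := Real.sin_sq_add_cos_sq u
  apply linRec_aeval_two_mul_cos
  · simp only [map_sub, map_pow, aeval_X, map_ofNat, Real.sin_two_mul,
      Real.cos_two_mul, sin_three_mul_eq, Real.cos_three_mul]
    ring
  · simp only [map_sub, map_mul, map_pow, aeval_X, map_one, map_ofNat, Real.cos_add,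
      Real.sin_add, Real.sin_two_mul, Real.cos_two_mul, sin_three_mul_eq, Real.cos_three_mul]
    linear_combination (2 * Real.sin u * Real.cos u * (8 * Real.cos u ^ 2 - 1) * (4 * Real.cos u ^ 2 - 1)) * h

theorem plasticPolyAux_aeval_cos (u : ℝ) (k : ℕ) :
    aeval (2 * Real.cos (2 * u)) (plasticPolyAux k) * Real.sin u =
      (Real.sin u * (8 * Real.cos u ^ 2 - 1)) * Real.cos (2 * u + k * (2 * u)) +
        (-Real.cos u) * Real.sin (2 * u + k * (2 * u)) := by
  have h := Real.sin_sq_add_cos_sq u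
  apply linRec_aeval_two_mul_cos
  · simp only [map_sub, map_add, map_pow, aeval_X, map_one, Real.sin_two_mul, Real.cos_two_mul]
    ring
  · simp only [map_sub, map_add, map_mul, map_pow, aeval_X, map_ofNat, Real.cos_add,
      Real.sin_add, Real.sin_two_mul, Real.cos_two_mul]
    linear_combination (4 * Real.sin u * Real.cos u ^ 2 * (8 * Real.cos u ^ 2 - 1)) * h

theorem plasticPolyOne_aeval_add_inv {x : ℂ} (hx : x ≠ 0) (k : ℕ) :
    aeval (x + x⁻¹) (plasticPolyOne k) *
      (x ^ 2 * (x + 1)) * x ^ k = x ^ (2 * k) * (x ^ 2 * (x ^ 3 - x - 1)) - (x ^ 3 + x ^ 2 - 1) := by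
  apply linRec_aeval_add_inv hx <;>
  · simp only [map_sub, map_add, map_mul, map_pow, aeval_X, map_one, map_ofNat]
    field_simp
    ring

theorem plasticPolyFive_aeval_add_inv {x : ℂ} (hx : x ≠ 0) (k : ℕ) :
    aeval (x + x⁻¹) (plasticPolyFive k) *
      (x ^ 2 * (x ^ 2 - 1)) * x ^ k =
        x ^ (2 * k) * (x ^ 3 * (x ^ 3 - x - 1)) - -(x ^ 3 + x ^ 2 - 1) := by
  apply linRec_aeval_add_inv hx <;>
  · simp only [map_sub, map_mul, map_pow, aeval_X, map_one, map_ofNat]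
    field_simp
    ring

theorem plasticPolyAux_aeval_add_inv {x : ℂ} (hx : x ≠ 0) (k : ℕ) :
    aeval (x + x⁻¹) (plasticPolyAux k) *
      (x ^ 2 * (x - 1)) * x ^ k = x ^ (2 * k) * (x ^ 2 * (x ^ 3 - x - 1)) - -(x ^ 3 + x ^ 2 - 1) := by
  apply linRec_aeval_add_inv hx <;>
  · simp only [map_sub, map_add, map_mul, map_pow, aeval_X, map_one, map_ofNat]
    field_simp
    ring

theorem neg_one_pow_mul_lt_zero {w y e : ℝ} {i : ℕ} (hw : 0 < w) (he : 0 < e)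
    (h : y * w = -e * (-1) ^ i) : (-1) ^ i * y < 0 := by
  have h1 : ((-1 : ℝ) ^ i) * (-1) ^ i = 1 := by rw [← mul_pow]; simp
  have h2 : ((-1) ^ i * y) * w = -e := by linear_combination (-1) ^ i * h - e * h1
  by_contra! h3
  nlinarith [mul_nonneg h3 hw.le]

theorem plasticPolyOne_spec {k : ℕ} (hk : k % 6 = 5) (hk11 : 11 ≤ k) :
    ∃ T : ℤ[X], T.Monic ∧ Irreducible T ∧ T.natDegree = k + 2 ∧
      (T.coeff 0 = 1 ∨ T.coeff 0 = -1) ∧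
      ∀ z : ℂ, aeval z T = 0 → z.im = 0 ∧ -2.08 < z.re ∧ z.re < 2.08 := by
  have hda : (X ^ 2 - X - 3 : ℤ[X]).natDegree = 2 := by compute_degree!
  have hdb : (X ^ 3 - X ^ 2 - 3 * X + 1 : ℤ[X]).natDegree = 3 := by compute_degree!
  obtain ⟨hmonic, hdeg⟩ : (plasticPolyOne k).Monic ∧ (plasticPolyOne k).natDegree = _ :=
    linRec_monic_natDegree monic_X (by simp) (by monicity!) (by monicity!)
      (by rw [hda, hdb, natDegree_X]) k
  rw [hda, natDegree_X, mul_one, add_comm] at hdeg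
  have hpi := Real.pi_pos
  have hk1 : (0 : ℝ) < k + 1 := by positivity
  have hmain := irreducible_of_alternating_cos (T := plasticPolyOne k) (n := k + 1)
    (θ := fun i => i * (Real.pi / (k + 1))) hmonic (by omega) dvd_rfl hmonic hdeg
    (fun i j hij => by dsimp only; gcongr) (by simp) ?_ ?_ ?_ ?_ ?_ ?_
  · exact ⟨_, hmonic, hmain.1, hdeg, linRec_coeff_zero_of_odd (by simp) (by simp)
      (Nat.odd_iff.2 (by omega)), hmain.2⟩
  · intro i hi
    have : (i : ℝ) < k + 1 := by exact_mod_cast hi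
    rw [← mul_div_assoc, div_lt_iff₀ hk1]
    nlinarith
  · push_cast
    field_simp
    rfl
  · apply linRec_aeval_pos hk11 <;>
    · simp only [linRec, map_sub, map_add, map_mul, map_pow, aeval_X, map_one, map_ofNat]
      norm_num
  · intro i hi
    have hi' : (i : ℝ) < k + 1 := by exact_mod_cast hi
    have hlt : i * (Real.pi / (k + 1)) < Real.pi := by
      rw [← mul_div_assoc, div_lt_iff₀ hk1]
      nlinarith
    have hcos : 0 < Real.cos (i * (Real.pi / (k + 1)) / 2) := Real.cos_pos_of_mem_Ioo
      ⟨by linarith [show 0 ≤ i * (Real.pi / (k + 1)) by positivity], by linarith⟩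
    have h := plasticPolyOne_aeval_cos (i * (Real.pi / (k + 1)) / 2) k
    rw [mul_div_cancel₀ _ two_ne_zero, show i * (Real.pi / (k + 1)) + k * (i * (Real.pi / (k + 1))) =
      i * Real.pi by field_simp; ring, Real.cos_nat_mul_pi, Real.sin_nat_mul_pi, mul_zero,
      add_zero] at h
    exact neg_one_pow_mul_lt_zero hcos hcos h
  · rw [plasticPolyOne, linRec_aeval_neg_two (r := 3) (s := 2)
      (by simp only [map_sub, map_pow, aeval_X, map_ofNat]; norm_num)
      (by simp only [map_sub, map_add, map_mul, map_pow, aeval_X, map_one, map_ofNat]; norm_num)]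
    have h1 : ((-1 : ℝ) ^ k) * (-1) ^ k = 1 := by rw [← mul_pow]; simp
    rw [pow_succ, show (-1 : ℝ) ^ k * -1 * ((-1) ^ k * (3 + k * 2)) = -(3 + k * 2) by
      linear_combination -(3 + k * 2) * h1]
    linarith
  · intro x m hm hxm hx2 h
    have hx0 : x ≠ 0 := by rintro rfl; simp [hm.ne'] at hxm
    have h1 := plasticPolyOne_aeval_add_inv hx0 k
    rw [h] at h1
    exact plastic_relation_false_of_twelve_dvd (n := 2 * k + 2) hm hxm hx2 (by omega)
      (by linear_combination -h1)

theorem cos_sin_nat_add_half_mul_pi (i : ℕ) :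
    Real.cos ((i + 1 / 2) * Real.pi) = 0 ∧ Real.sin ((i + 1 / 2) * Real.pi) = (-1) ^ i := by
  rw [show (i + 1 / 2 : ℝ) * Real.pi = i * Real.pi + Real.pi / 2 by ring, Real.cos_add_pi_div_two,
    Real.sin_add_pi_div_two, Real.sin_nat_mul_pi, Real.cos_nat_mul_pi]
  simp

theorem plasticPolyFive_spec {k : ℕ} (hk : k % 6 = 3) (hk5 : k % 5 ≠ 2) :
    ∃ T : ℤ[X], T.Monic ∧ Irreducible T ∧ T.natDegree = k + 2 ∧
      (T.coeff 0 = 1 ∨ T.coeff 0 = -1) ∧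
      ∀ z : ℂ, aeval z T = 0 → z.im = 0 ∧ -2.08 < z.re ∧ z.re < 2.08 := by
  have hda : (X ^ 2 - 2 : ℤ[X]).natDegree = 2 := by compute_degree!
  have hdb : (X ^ 3 - 3 * X - 1 : ℤ[X]).natDegree = 3 := by compute_degree!
  obtain ⟨hmonic, hdeg⟩ : (plasticPolyFive k).Monic ∧ (plasticPolyFive k).natDegree = _ :=
    linRec_monic_natDegree monic_X (by simp) (by monicity!) (by monicity!)
      (by rw [hda, hdb, natDegree_X]) k
  rw [hda, natDegree_X, mul_one, add_comm] at hdeg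
  have hpi := Real.pi_pos
  have hk1 : (0 : ℝ) < 2 * k + 3 := by positivity
  have hθ {i : ℕ} (hi : i < k + 1) : (i + 1 / 2) * (2 * Real.pi / (2 * k + 3)) < Real.pi := by
    have : (i : ℝ) < k + 1 := by exact_mod_cast hi
    rw [← mul_div_assoc, div_lt_iff₀ hk1]
    nlinarith
  have hmain := irreducible_of_alternating_cos (T := plasticPolyFive k) (n := k + 1)
    (θ := fun i => (i + 1 / 2) * (2 * Real.pi / (2 * k + 3))) hmonic (by omega) dvd_rfl hmonic hdeg
    (fun i j hij => by dsimp only; gcongr) (by positivity) (fun i hi => hθ hi) ?_ ?_ ?_ ?_ ?_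
  · exact ⟨_, hmonic, hmain.1, hdeg, linRec_coeff_zero_of_odd (by simp) (by simp)
      (Nat.odd_iff.2 (by omega)), hmain.2⟩
  · refine le_of_eq ?_
    push_cast
    field_simp
    ring
  · apply linRec_aeval_pos (m := 1) (by omega) <;>
    · simp only [linRec, map_sub, map_mul, map_pow, aeval_X, map_one, map_ofNat]
      norm_num
  · intro i hi
    have hlt := hθ hi
    have hpos : 0 < (i + 1 / 2) * (2 * Real.pi / (2 * k + 3)) := by positivity
    have h := plasticPolyFive_aeval_cos ((i + 1 / 2) * (2 * Real.pi / (2 * k + 3)) / 2) k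
    rw [mul_div_cancel₀ _ two_ne_zero, show 3 * ((i + 1 / 2) * (2 * Real.pi / (2 * k + 3)) / 2) +
      k * ((i + 1 / 2) * (2 * Real.pi / (2 * k + 3))) = (i + 1 / 2) * Real.pi by field_simp; ring,
      (cos_sin_nat_add_half_mul_pi i).1, (cos_sin_nat_add_half_mul_pi i).2, mul_zero, zero_add] at h
    exact neg_one_pow_mul_lt_zero (Real.sin_pos_of_pos_of_lt_pi hpos hlt)
      (Real.cos_pos_of_mem_Ioo ⟨by linarith, by linarith⟩) h
  · rw [plasticPolyFive, linRec_aeval_neg_two (r := 2) (s := 1)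
      (by simp only [map_sub, map_pow, aeval_X, map_ofNat]; norm_num)
      (by simp only [map_sub, map_mul, map_pow, aeval_X, map_one, map_ofNat]; norm_num)]
    have h1 : ((-1 : ℝ) ^ k) * (-1) ^ k = 1 := by rw [← mul_pow]; simp
    rw [pow_succ, show (-1 : ℝ) ^ k * -1 * ((-1) ^ k * (2 + k * 1)) = -(2 + k) by
      linear_combination -(2 + k) * h1]
    linarith
  · intro x m hm hxm hx2 h
    have hx0 : x ≠ 0 := by rintro rfl; simp [hm.ne'] at hxm
    have h1 := plasticPolyFive_aeval_add_inv hx0 k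
    rw [h] at h1
    exact plastic_relation_neg_false (n := 2 * k + 3) hm hxm hx2 (by omega) (by omega)
      (by linear_combination -h1)

/-- The quotients of the polynomials `plasticPolyAux (3 * k + 1)` by `X + 1`. -/
noncomputable def plasticPolyFactor : ℕ → ℤ[X] :=
  linRec (X ^ 3 - 3 * X) (X ^ 2 - 3) (X ^ 5 - 6 * X ^ 3 + 8 * X - 1)

theorem add_one_mul_plasticPolyFactor (k : ℕ) :
    (X + 1) * plasticPolyFactor k = plasticPolyAux (3 * k + 1) := by
  induction k using Nat.twoStepInduction with
  | zero => simp only [plasticPolyFactor, plasticPolyAux, linRec]; ring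
  | one => simp only [plasticPolyFactor, plasticPolyAux, linRec]; ring
  | more k ih0 ih1 =>
    have h : plasticPolyAux (3 * (k + 2) + 1) =
        (X ^ 3 - 3 * X) * plasticPolyAux (3 * (k + 1) + 1) - plasticPolyAux (3 * k + 1) := by
      simp only [plasticPolyAux, linRec, show 3 * (k + 2) + 1 = 3 * k + 1 + 6 by ring,
        show 3 * (k + 1) + 1 = 3 * k + 1 + 3 by ring]
      ring
    rw [h, ← ih0, ← ih1, plasticPolyFactor, linRec]
    ring

theorem plasticPolyFactor_aeval_neg_one (k : ℕ) :
    aeval (-1 : ℂ) (plasticPolyFactor k) = -(2 + 2 * k) := by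
  induction k using Nat.twoStepInduction with
  | zero =>
    simp only [plasticPolyFactor, linRec, map_sub, map_pow, aeval_X, map_ofNat]
    norm_num
  | one =>
    simp only [plasticPolyFactor, linRec, map_sub, map_add, map_mul, map_pow, aeval_X, map_one,
      map_ofNat]
    norm_num
  | more k ih0 ih1 =>
    rw [plasticPolyFactor] at *
    rw [aeval_linRec, ih0, ih1]
    simp only [map_sub, map_mul, map_pow, aeval_X, map_ofNat]
    push_cast
    ring

theorem plasticPolyFactor_spec {k : ℕ} (hk : k % 10 = 9) :
    ∃ T : ℤ[X], T.Monic ∧ Irreducible T ∧ T.natDegree = 3 * k + 2 ∧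
      (T.coeff 0 = 1 ∨ T.coeff 0 = -1) ∧
      ∀ z : ℂ, aeval z T = 0 → z.im = 0 ∧ -2.08 < z.re ∧ z.re < 2.08 := by
  have hda : (X ^ 2 - 3 : ℤ[X]).natDegree = 2 := by compute_degree!
  have hdb : (X ^ 5 - 6 * X ^ 3 + 8 * X - 1 : ℤ[X]).natDegree = 5 := by compute_degree!
  have hdq : (X ^ 3 - 3 * X : ℤ[X]).natDegree = 3 := by compute_degree!
  obtain ⟨hmonic, hdeg⟩ : (plasticPolyFactor k).Monic ∧ (plasticPolyFactor k).natDegree = _ :=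
    linRec_monic_natDegree (by monicity!) (by omega) (by monicity!) (by monicity!)
      (by rw [hda, hdb, hdq]) k
  rw [hda, hdq, add_comm, mul_comm] at hdeg
  have hF := add_one_mul_plasticPolyFactor k
  have hFmonic : (plasticPolyAux (3 * k + 1)).Monic := hF ▸ (monic_X_add_C 1).mul hmonic
  have hFdeg : (plasticPolyAux (3 * k + 1)).natDegree = 3 * k + 2 + 1 := by
    rw [← hF, ← C_1, (monic_X_add_C 1).natDegree_mul hmonic, natDegree_X_add_C, hdeg, add_comm]
  have hpi := Real.pi_pos
  have hk1 : (0 : ℝ) < 3 * k + 2 := by positivity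
  have hθ {i : ℕ} (hi : i < 3 * k + 2) : (i + 1 / 2) * (Real.pi / (3 * k + 2)) < Real.pi := by
    have : (i + 1 : ℝ) ≤ 3 * k + 2 := by exact_mod_cast hi
    rw [← mul_div_assoc, div_lt_iff₀ hk1]
    nlinarith
  have hmain := irreducible_of_alternating_cos (n := 3 * k + 2)
    (θ := fun i => (i + 1 / 2) * (Real.pi / (3 * k + 2))) hmonic (by omega) (Dvd.intro_left _ hF)
    hFmonic hFdeg (fun i j hij => by dsimp only; gcongr) (by positivity) (fun i hi => hθ hi)
    ?_ ?_ ?_ ?_ ?_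
  · exact ⟨_, hmonic, hmain.1, hdeg, linRec_coeff_zero_of_odd (by simp) (by simp)
      (Nat.odd_iff.2 (by omega)), hmain.2⟩
  · rw [← mul_div_assoc, le_div_iff₀ hk1]
    push_cast
    nlinarith
  · apply linRec_aeval_pos (m := 0) (by omega) <;>
    · simp only [linRec, map_sub, map_add, map_mul, map_pow, aeval_X, map_one, map_ofNat]
      norm_num
  · intro i hi
    have hlt := hθ hi
    have hpos : 0 < (i + 1 / 2) * (Real.pi / (3 * k + 2)) := by positivity
    have h := plasticPolyAux_aeval_cos ((i + 1 / 2) * (Real.pi / (3 * k + 2)) / 2) (3 * k + 1)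
    rw [mul_div_cancel₀ _ two_ne_zero, show (i + 1 / 2) * (Real.pi / (3 * k + 2)) +
      (3 * k + 1 : ℕ) * ((i + 1 / 2) * (Real.pi / (3 * k + 2))) = (i + 1 / 2) * Real.pi by
        push_cast; field_simp; ring,
      (cos_sin_nat_add_half_mul_pi i).1, (cos_sin_nat_add_half_mul_pi i).2, mul_zero, zero_add] at h
    exact neg_one_pow_mul_lt_zero (Real.sin_pos_of_pos_of_lt_pi (by linarith) (by linarith))
      (Real.cos_pos_of_mem_Ioo ⟨by linarith, by linarith⟩) h
  · rw [plasticPolyAux, linRec_aeval_neg_two (r := 1) (s := 0)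
      (by simp only [map_sub, map_add, map_pow, aeval_X, map_one]; norm_num)
      (by simp only [map_sub, map_add, map_mul, map_pow, aeval_X, map_ofNat]; norm_num)]
    have h1 : ((-1 : ℝ) ^ (3 * k)) * (-1) ^ (3 * k) = 1 := by rw [← mul_pow]; simp
    rw [pow_succ, pow_succ]
    linarith
  · intro x m hm hxm hx2 h
    have hx0 : x ≠ 0 := by rintro rfl; simp [hm.ne'] at hxm
    have h1 := plasticPolyAux_aeval_add_inv hx0 (3 * k + 1)
    rw [← hF, map_mul, h] at h1
    have h3 := cube_eq_one_of_plastic_relation_neg (n := 2 * (3 * k + 1) + 2) hm hxm hx2 (by omega)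
      (by linear_combination -h1)
    have hx1 : x - 1 ≠ 0 := fun h0 => hx2 (by rw [sub_eq_zero.1 h0]; norm_num)
    have h4 : x ^ 2 + x + 1 = 0 := by
      apply mul_left_cancel₀ hx1
      linear_combination h3
    have h5 : x + x⁻¹ = -1 := by
      field_simp
      linear_combination h4
    rw [h5, plasticPolyFactor_aeval_neg_one, neg_eq_zero] at h
    norm_cast at h
    omega

theorem exists_totally_real_unit_poly_seven :
    ∃ T : ℤ[X], T.Monic ∧ Irreducible T ∧ T.natDegree = 7 ∧
      (T.coeff 0 = 1 ∨ T.coeff 0 = -1) ∧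
      ∀ z : ℂ, aeval z T = 0 → z.im = 0 ∧ -2.08 < z.re ∧ z.re < 2.08 := by
  obtain ⟨T, hT⟩ : ∃ T : ℤ[X], T = X ^ 7 - 8 * X ^ 5 + 19 * X ^ 3 - 12 * X - 1 := ⟨_, rfl⟩
  have hdeg : T.natDegree = 7 := by rw [hT]; compute_degree!
  have hmonic : T.Monic := by rw [hT]; monicity!
  have heval {R : Type} [CommRing R] (t : R) :
      aeval t T = t ^ 7 - 8 * t ^ 5 + 19 * t ^ 3 - 12 * t - 1 := by
    simp only [hT, map_sub, map_add, map_mul, map_pow, aeval_X, map_one, map_ofNat]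
  have hmain := irreducible_of_alternating (T := T) (F := T) (n := 7)
    (a := fun i => [2.08, 2, 1.5, 0, -0.5, -1, -1.9, -2].getD i 0) hmonic (by omega) dvd_rfl
    hmonic hdeg (by intro i hi; interval_cases i <;> norm_num)
    (by intro i hi; simp only [heval]; interval_cases i <;> norm_num) rfl
    (by intro i hi h1; interval_cases i <;> norm_num)
    (by intro i hi; interval_cases i <;> norm_num) ?_
  · exact ⟨T, hmonic, hmain.1, hdeg, Or.inr (by simp [hT]), hmain.2⟩
  intro x k hk hxk _ h
  have hx0 : x ≠ 0 := by rintro rfl; simp [hk.ne'] at hxk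
  obtain ⟨f, hf⟩ : ∃ f : ℤ[X], f = (X ^ 2 + 1) ^ 7 - 8 * (X ^ 2 + 1) ^ 5 * X ^ 2 +
    19 * (X ^ 2 + 1) ^ 3 * X ^ 4 - 12 * (X ^ 2 + 1) * X ^ 6 - X ^ 7 := ⟨_, rfl⟩
  have hfT {y : ℂ} (hy : y ≠ 0) : aeval y f = 0 ↔ aeval (y + y⁻¹) T = 0 := by
    have : aeval y f = y ^ 7 * aeval (y + y⁻¹) T := by
      rw [heval]
      simp only [hf, map_sub, map_add, map_mul, map_pow, aeval_X, map_one, map_ofNat]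
      field_simp
    simp [this, hy]
  rcases (IsPrimitiveRoot.orderOf x).aeval_neg_or_sq
    (orderOf_pos_iff.2 (isOfFinOrder_iff_pow_eq_one.2 ⟨k, hk, hxk⟩)) ((hfT hx0).2 h) with
    h1 | ⟨-, h1⟩ | h1
  · rw [hfT (by simpa), show -x + (-x)⁻¹ = -(x + x⁻¹) by rw [inv_neg]; ring, heval] at h1
    rw [heval] at h
    have : (2 : ℂ) = 0 := by linear_combination -h - h1
    norm_num at this
  · rw [hfT (by simpa), show x ^ 2 + (x ^ 2)⁻¹ = (x + x⁻¹) ^ 2 - 2 by field_simp; ring, heval] at h1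
    rw [heval] at h
    generalize x + x⁻¹ = t at h h1
    have : (2 : ℂ) = 0 := by
      linear_combination -(5 * t - 8 * t ^ 2 - 29 * t ^ 3 + 54 * t ^ 4 + 51 * t ^ 5 - 77 * t ^ 6
        - 35 * t ^ 7 + 44 * t ^ 8 + 10 * t ^ 9 - 11 * t ^ 10 - t ^ 11 + t ^ 12) * h
        - (2 - 5 * t - 4 * t ^ 2 + 5 * t ^ 3 + t ^ 4 - t ^ 5) * h1
    norm_num at this
  · rw [hfT (by simpa), show -x ^ 2 + (-x ^ 2)⁻¹ = -((x + x⁻¹) ^ 2 - 2) by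
      rw [inv_neg]; field_simp; ring, heval] at h1
    rw [heval] at h
    generalize x + x⁻¹ = t at h h1
    have : (2 : ℂ) = 0 := by
      linear_combination -(-3 * t - 8 * t ^ 2 + 25 * t ^ 3 + 30 * t ^ 4 - 50 * t ^ 5 - 27 * t ^ 6
        + 35 * t ^ 7 + 9 * t ^ 8 - 10 * t ^ 9 - t ^ 10 + t ^ 11) * h
        - (2 + 3 * t - 4 * t ^ 2 - t ^ 3 + t ^ 4) * h1
    norm_num at this

/-- For every prime `p > 3` there exists a monic irreducible polynomial `T ∈ ℤ[X]` of degree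
`p`, with constant term `±1`, all of whose complex roots are real and lie in `(-2.08, 2.08)`. -/
theorem exists_totally_real_unit_poly (p : ℕ) (hp : p.Prime) (hp3 : 3 < p) :
    ∃ T : Polynomial ℤ, T.Monic ∧ Irreducible T ∧ T.natDegree = p ∧
      (T.coeff 0 = 1 ∨ T.coeff 0 = -1) ∧
      ∀ z : ℂ, aeval z T = 0 → z.im = 0 ∧ -2.08 < z.re ∧ z.re < 2.08 := by
  have h2 := (Nat.Prime.eq_one_or_self_of_dvd hp 2).mt (by omega)
  have h3 := (Nat.Prime.eq_one_or_self_of_dvd hp 3).mt (by omega)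
  obtain ⟨k, rfl⟩ : ∃ k, p = k + 2 := ⟨p - 2, by omega⟩
  have h6 : k % 6 = 5 ∨ k % 6 = 3 := by omega
  rcases h6 with h6 | h6
  · rcases Nat.lt_or_ge k 11 with hk | hk
    · obtain rfl : k = 5 := by omega
      exact exists_totally_real_unit_poly_seven
    · exact plasticPolyOne_spec h6 hk
  · by_cases h5 : k % 5 = 2
    · obtain ⟨m, rfl⟩ : ∃ m, k = 3 * m := ⟨k / 3, by omega⟩
      exact plasticPolyFactor_spec (by omega)
    · exact plasticPolyFive_spec h6 h5
end

section
/- Let E ⊆ ℂ be the splitting field over ℚ of X³ − X² + 1 and let F = ℚ(√(−23)) ⊆ E. Then 3 is not the norm of any element of E over F: there is no α ∈ E with N_{E/F}(α) = 3. Consequently, the class of 3 in the quotient group F^× / N_{E/F}(E^×) has order exactly 3. -/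
open Polynomial

/-- The splitting field inside `ℂ` of `X ^ 3 - X ^ 2 + 1` over `ℚ`. -/
noncomputable def Esplit : IntermediateField ℚ ℂ :=
  IntermediateField.adjoin ℚ ((X ^ 3 - X ^ 2 + 1 : Polynomial ℚ).rootSet ℂ)

/-- The field `F = ℚ(√(-23)) ⊆ ℂ`. -/
noncomputable def Fsqrt : IntermediateField ℚ ℂ :=
  IntermediateField.adjoin ℚ {(Complex.I * Real.sqrt 23 : ℂ)}

/-- The norm of `a + bθ + cθ²` for a root `θ` of `X ^ 3 - X ^ 2 + 1`, as a cubic form. -/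
def cubicNormForm {R : Type*} [CommRing R] (a b c : R) : R :=
  a * (a * (a + b + c) + c * (b + c)) - b * ((b + c) ^ 2 - c * (a + b + c)) +
    c * (c ^ 2 + a * (b + c))

lemma map_cubicNormForm {R S : Type*} [CommRing R] [CommRing S] (f : R →+* S) (a b c : R) :
    f (cubicNormForm a b c) = cubicNormForm (f a) (f b) (f c) := by
  simp [cubicNormForm]

lemma cubicNormForm_zmod_three :
    ∀ a b c : ZMod 3, cubicNormForm a b c = 0 → a = 0 ∧ b = 0 ∧ c = 0 := by
  unfold cubicNormForm
  decide

lemma padicInt_toZMod_eq_zero_iff {p : ℕ} [Fact p.Prime] (x : ℤ_[p]) :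
    PadicInt.toZMod x = 0 ↔ ‖x‖ < 1 := by
  rw [← RingHom.mem_ker, PadicInt.ker_toZMod, IsLocalRing.mem_maximalIdeal,
    PadicInt.mem_nonunits]

lemma norm_cubicNormForm_padicInt (a b c : ℤ_[3]) (h : ‖a‖ = 1 ∨ ‖b‖ = 1 ∨ ‖c‖ = 1) :
    ‖cubicNormForm a b c‖ = 1 := by
  refine le_antisymm (PadicInt.norm_le_one _) (not_lt.mp fun hlt => ?_)
  rw [← padicInt_toZMod_eq_zero_iff, map_cubicNormForm] at hlt
  obtain ⟨ha, hb, hc⟩ := cubicNormForm_zmod_three _ _ _ hlt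
  rw [padicInt_toZMod_eq_zero_iff] at ha hb hc
  rcases h with h | h | h <;> linarith

lemma exists_norm_eq_max {V : Type*} [Norm V] (a b c : V) :
    ∃ m : V, max ‖a‖ (max ‖b‖ ‖c‖) = ‖m‖ ∧ (m = a ∨ m = b ∨ m = c) := by
  rcases max_choice ‖a‖ (max ‖b‖ ‖c‖) with h | h
  · exact ⟨a, h, .inl rfl⟩
  · rcases max_choice ‖b‖ ‖c‖ with h' | h'
    · exact ⟨b, h.trans h', .inr (.inl rfl)⟩
    · exact ⟨c, h.trans h', .inr (.inr rfl)⟩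

lemma norm_cubicNormForm_padic (a b c : ℚ_[3]) :
    ‖cubicNormForm a b c‖ = max ‖a‖ (max ‖b‖ ‖c‖) ^ 3 := by
  obtain ⟨m, hm, hmem⟩ := exists_norm_eq_max a b c
  have ha : ‖a‖ ≤ ‖m‖ := hm ▸ le_max_left _ _
  have hb : ‖b‖ ≤ ‖m‖ := hm ▸ (le_max_left _ _).trans (le_max_right _ _)
  have hc : ‖c‖ ≤ ‖m‖ := hm ▸ (le_max_right _ _).trans (le_max_right _ _)
  rw [hm]
  rcases eq_or_ne m 0 with rfl | hm0
  · simp only [norm_zero, norm_le_zero_iff] at ha hb hc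
    simp [ha, hb, hc, cubicNormForm]
  have key (x : ℚ_[3]) (hx : ‖x‖ ≤ ‖m‖) : ∃ y : ℤ_[3], x = m * y :=
    ⟨⟨x / m, by rw [norm_div]; exact div_le_one_of_le₀ hx (norm_nonneg _)⟩,
      (mul_div_cancel₀ x hm0).symm⟩
  obtain ⟨a, rfl⟩ := key a ha
  obtain ⟨b, rfl⟩ := key b hb
  obtain ⟨c, rfl⟩ := key c hc
  have hunit (y : ℤ_[3]) (hy : m = m * y) : ‖y‖ = 1 := by
    have : (y : ℚ_[3]) = 1 := mul_left_cancel₀ hm0 (by rw [← hy, mul_one])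
    rw [PadicInt.norm_def, this, norm_one]
  have hform : cubicNormForm (m * a) (m * b) (m * c) =
      m ^ 3 * ((cubicNormForm a b c : ℤ_[3]) : ℚ_[3]) := by
    simp only [cubicNormForm]
    push_cast
    ring
  rw [hform, norm_mul, norm_pow, ← PadicInt.norm_def, norm_cubicNormForm_padicInt, mul_one]
  exact hmem.imp (hunit a) (Or.imp (hunit b) (hunit c))

lemma cubicNormForm_padic_ne_three (a b c : ℚ_[3]) : cubicNormForm a b c ≠ 3 := by
  intro h
  have hn := norm_cubicNormForm_padic a b c
  have h3 : ‖(3 : ℚ_[3])‖ = (3 : ℝ)⁻¹ := by exact_mod_cast Padic.norm_p (p := 3)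
  obtain ⟨m, hm, -⟩ := exists_norm_eq_max a b c
  rw [h, h3, hm] at hn
  have hm0 : m ≠ 0 := by
    rintro rfl
    norm_num at hn
  rw [Padic.norm_eq_zpow_neg_valuation hm0, ← zpow_natCast, ← zpow_mul, ← zpow_neg_one] at hn
  have := zpow_right_injective₀ (a := (3 : ℝ)) (by norm_num) (by norm_num) hn
  push_cast at this
  omega

lemma cube_sub_sq_add_one_ne_zero_padic (r : ℚ_[3]) : r ^ 3 - r ^ 2 + 1 ≠ 0 := by
  intro h
  have h0 : cubicNormForm r (-1) 0 = 0 := by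
    refine Eq.trans ?_ h
    unfold cubicNormForm
    ring
  have hn := norm_cubicNormForm_padic r (-1) 0
  rw [h0, norm_zero] at hn
  have : (1 : ℝ) ≤ max ‖r‖ (max ‖(-1 : ℚ_[3])‖ 0) := by simp
  exact absurd hn.symm (one_pos.trans_le (one_le_pow₀ this)).ne'

lemma exists_padic_sq_eq_neg_twentyThree : ∃ z : ℚ_[3], z ^ 2 = -23 := by
  have h3 : ‖(3 : ℤ_[3])‖ = (3 : ℝ)⁻¹ := by exact_mod_cast PadicInt.norm_p (p := 3)
  have h24 : ‖(24 : ℤ_[3])‖ < 1 := by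
    have : (24 : ℤ_[3]) = 3 * 8 := by norm_num
    rw [this, norm_mul, h3]
    have := PadicInt.norm_le_one (8 : ℤ_[3])
    linarith
  have h2 : ‖(2 : ℤ_[3])‖ = 1 := by
    refine le_antisymm (PadicInt.norm_le_one _) (not_lt.mp fun hlt => ?_)
    rw [← padicInt_toZMod_eq_zero_iff, map_ofNat] at hlt
    exact absurd hlt (by decide)
  obtain ⟨z, hz, -⟩ := hensels_lemma (p := 3) (F := (X ^ 2 + 23 : Polynomial ℤ)) (a := 1) (by
    have h₁ : aeval (1 : ℤ_[3]) (X ^ 2 + 23 : Polynomial ℤ) = 24 := by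
      simp only [map_add, map_pow, aeval_X, map_ofNat]
      norm_num
    have h₂ : aeval (1 : ℤ_[3]) (derivative (X ^ 2 + 23 : Polynomial ℤ)) = 2 := by
      simp [map_ofNat]
    rw [h₁, h₂, h2]
    simpa using h24)
  simp only [map_add, map_pow, aeval_X, map_ofNat] at hz
  refine ⟨z, eq_neg_of_add_eq_zero_left ?_⟩
  exact_mod_cast congrArg (fun x : ℤ_[3] => (x : ℚ_[3])) hz

lemma I_mul_sqrt_sq : (Complex.I * Real.sqrt 23 : ℂ) ^ 2 = -23 := by
  rw [mul_pow, Complex.I_sq, ← Complex.ofReal_pow, Real.sq_sqrt (by norm_num)]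
  norm_num

lemma exists_ringHom_Fsqrt_padic : Nonempty (Fsqrt →+* ℚ_[3]) := by
  obtain ⟨z, hz⟩ := exists_padic_sq_eq_neg_twentyThree
  have hroot : aeval (Complex.I * Real.sqrt 23 : ℂ) (X ^ 2 + 23 : ℚ[X]) = 0 := by
    simp only [map_add, map_pow, aeval_X, map_ofNat, I_mul_sqrt_sq]
    norm_num
  have hmonic : (X ^ 2 + 23 : ℚ[X]).Monic := by
    monicity!
  have hfactor : (X ^ 2 + 23 : ℚ[X]).map (algebraMap ℚ ℚ_[3]) = (X - C z) * (X + C z) := by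
    have : (23 : ℚ_[3][X]) = C (-z ^ 2) := by rw [hz, neg_neg]; exact (map_ofNat C 23).symm
    simp only [Polynomial.map_add, Polynomial.map_pow, map_X, Polynomial.map_ofNat, this]
    simp only [map_neg, map_pow]
    ring
  obtain ⟨φ⟩ := IntermediateField.nonempty_algHom_adjoin_of_splits (F := ℚ) (K := ℚ_[3])
    (S := {(Complex.I * Real.sqrt 23 : ℂ)}) (by
      rintro s rfl
      refine ⟨⟨_, hmonic, hroot⟩, ?_⟩
      refine Splits.of_dvd ?_ (hmonic.map (algebraMap ℚ ℚ_[3])).ne_zero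
        (Polynomial.map_dvd _ (minpoly.dvd ℚ _ hroot))
      rw [hfactor]
      exact (Splits.X_sub_C z).mul (Splits.X_add_C z))
  exact ⟨φ.toRingHom⟩

lemma norm_eq_cubicNormForm {K L : Type*} [Field K] [Field L] [Algebra K L]
    (pb : PowerBasis K L) (hdim : pb.dim = 3) (hgen : pb.gen ^ 3 - pb.gen ^ 2 + 1 = 0) (x : L) :
    ∃ a b c : K, Algebra.norm K x = cubicNormForm a b c := by
  let B : Module.Basis (Fin 3) K L := pb.basis.reindex (finCongr hdim)
  have hB (i : Fin 3) : B i = pb.gen ^ (i : ℕ) := by simp [B]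
  have hmul (u v w : K) (i : Fin 3) : B.repr (u • B 0 + v • B 1 + w • B 2) i = ![u, v, w] i := by
    fin_cases i <;> simp
  obtain ⟨a, b, c, hx⟩ : ∃ a b c : K, x = a • B 0 + b • B 1 + c • B 2 :=
    ⟨B.repr x 0, B.repr x 1, B.repr x 2, by
      rw [← Fin.sum_univ_three (fun i => B.repr x i • B i), B.sum_repr]⟩
  refine ⟨a, b, c, ?_⟩
  have h0 : x * B 0 = a • B 0 + b • B 1 + c • B 2 := by
    rw [hx]
    simp [hB]
  have h1 : x * B 1 = (-c) • B 0 + a • B 1 + (b + c) • B 2 := by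
    rw [hx]
    simp only [hB, Algebra.smul_def, map_neg, map_add, Fin.val_zero, Fin.val_one, Fin.val_two]
    linear_combination algebraMap K L c * hgen
  have h2 : x * B 2 = (-(b + c)) • B 0 + (-c) • B 1 + (a + b + c) • B 2 := by
    rw [hx]
    simp only [hB, Algebra.smul_def, map_neg, map_add, Fin.val_zero, Fin.val_one, Fin.val_two]
    linear_combination (algebraMap K L b + algebraMap K L c * (pb.gen + 1)) * hgen
  rw [Algebra.norm_eq_matrix_det B, Matrix.det_fin_three]
  simp only [Algebra.leftMulMatrix_eq_repr_mul, h0, h1, h2, hmul]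
  simp [cubicNormForm]
  ring

lemma natDegree_cubic (K : Type*) [Field K] : (X ^ 3 - X ^ 2 + 1 : K[X]).natDegree = 3 := by
  compute_degree!

lemma monic_cubic (K : Type*) [Field K] : (X ^ 3 - X ^ 2 + 1 : K[X]).Monic := by
  monicity!

lemma exists_root_cubic : ∃ θ : ℂ, θ ^ 3 - θ ^ 2 + 1 = 0 := by
  obtain ⟨θ, hθ⟩ := IsAlgClosed.exists_root (X ^ 3 - X ^ 2 + 1 : ℂ[X])
    (by rw [degree_eq_natDegree (monic_cubic ℂ).ne_zero, natDegree_cubic]; norm_num)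
  exact ⟨θ, by simpa using hθ⟩

lemma irreducible_cubic_Fsqrt : Irreducible (X ^ 3 - X ^ 2 + 1 : Fsqrt[X]) := by
  obtain ⟨σ⟩ := exists_ringHom_Fsqrt_padic
  refine irreducible_of_degree_le_three_of_not_isRoot (by simp [natDegree_cubic]) fun r hr => ?_
  refine cube_sub_sq_add_one_ne_zero_padic (σ r) ?_
  simpa [IsRoot.def] using congrArg σ hr

section SplittingField

variable {θ : ℂ}

lemma discr_identity (hθ : θ ^ 3 - θ ^ 2 + 1 = 0) :
    (3 * θ ^ 2 - 2 * θ) ^ 2 * (-3 * θ ^ 2 + 2 * θ + 1) = -23 := by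
  linear_combination (-27 * θ ^ 3 + 27 * θ ^ 2 + 23) * hθ

lemma derivative_ne_zero_of_root (hθ : θ ^ 3 - θ ^ 2 + 1 = 0) : 3 * θ ^ 2 - 2 * θ ≠ 0 := by
  intro h
  have := discr_identity hθ
  rw [h] at this
  norm_num at this

/-- The quotient of `√(-23)` by the derivative of `f = X ^ 3 - X ^ 2 + 1` at `θ` is the difference
of the two roots of `f` other than `θ`; its square is the discriminant of `f / (X - θ)`. -/
lemma rootDiff_sq (hθ : θ ^ 3 - θ ^ 2 + 1 = 0) :
    (Complex.I * Real.sqrt 23 / (3 * θ ^ 2 - 2 * θ)) ^ 2 = -3 * θ ^ 2 + 2 * θ + 1 := by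
  rw [div_pow, I_mul_sqrt_sq, ← discr_identity hθ]
  exact mul_div_cancel_left₀ _ (pow_ne_zero 2 (derivative_ne_zero_of_root hθ))

lemma mem_rootSet_cubic_iff (z : ℂ) :
    z ∈ (X ^ 3 - X ^ 2 + 1 : ℚ[X]).rootSet ℂ ↔ z ^ 3 - z ^ 2 + 1 = 0 := by
  rw [mem_rootSet_of_ne (monic_cubic ℚ).ne_zero]
  simp

lemma mem_Esplit_of_root {z : ℂ} (hz : z ^ 3 - z ^ 2 + 1 = 0) : z ∈ Esplit :=
  IntermediateField.subset_adjoin _ _ ((mem_rootSet_cubic_iff z).mpr hz)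

lemma Fsqrt_le_Esplit : Fsqrt ≤ Esplit := by
  obtain ⟨θ, hθ⟩ := exists_root_cubic
  refine IntermediateField.adjoin_simple_le_iff.mpr ?_
  have hd := rootDiff_sq hθ
  have hne := derivative_ne_zero_of_root hθ
  obtain ⟨d, hdef⟩ : ∃ d, d = Complex.I * Real.sqrt 23 / (3 * θ ^ 2 - 2 * θ) := ⟨_, rfl⟩
  rw [← hdef] at hd
  have hθE := mem_Esplit_of_root hθ
  have hηE : (1 - θ + d) / 2 ∈ Esplit := mem_Esplit_of_root (by
    linear_combination (1 - 3 * θ + d) / 8 * hd + hθ)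
  have heq : Complex.I * Real.sqrt 23 =
      (3 * θ ^ 2 - 2 * θ) * (2 * ((1 - θ + d) / 2) - 1 + θ) := by
    rw [← (eq_div_iff hne).mp hdef]
    ring
  rw [heq]
  have (n : ℕ) [n.AtLeastTwo] : (ofNat(n) : ℂ) ∈ Esplit := ofNat_mem Esplit n
  exact mul_mem (sub_mem (mul_mem (this 3) (pow_mem hθE 2)) (mul_mem (this 2) hθE))
    (add_mem (sub_mem (mul_mem (this 2) hηE) (one_mem _)) hθE)

open IntermediateField in
lemma extendScalars_eq_adjoin_root (hθ : θ ^ 3 - θ ^ 2 + 1 = 0) :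
    extendScalars Fsqrt_le_Esplit = adjoin Fsqrt {θ} := by
  refine le_antisymm ?_ (adjoin_simple_le_iff.mpr (mem_Esplit_of_root hθ))
  have hθM : θ ∈ adjoin Fsqrt {θ} := mem_adjoin_simple_self _ _
  have hδM : Complex.I * Real.sqrt 23 ∈ adjoin Fsqrt {θ} :=
    (adjoin Fsqrt {θ}).algebraMap_mem ⟨_, mem_adjoin_simple_self ℚ (Complex.I * Real.sqrt 23 : ℂ)⟩
  have hnum (n : ℕ) [n.AtLeastTwo] : (ofNat(n) : ℂ) ∈ adjoin Fsqrt {θ} :=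
    ofNat_mem (adjoin Fsqrt {θ}) n
  have hdM : Complex.I * Real.sqrt 23 / (3 * θ ^ 2 - 2 * θ) ∈ adjoin Fsqrt {θ} :=
    div_mem hδM (sub_mem (mul_mem (hnum 3) (pow_mem hθM 2)) (mul_mem (hnum 2) hθM))
  have hd := rootDiff_sq hθ
  generalize Complex.I * Real.sqrt 23 / (3 * θ ^ 2 - 2 * θ) = d at hd hdM
  suffices h : Esplit ≤ (adjoin Fsqrt {θ}).restrictScalars ℚ from fun x hx => h hx
  refine adjoin_le_iff.mpr fun z hz => ?_
  rw [mem_rootSet_cubic_iff] at hz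
  have hprod : (z - θ) * ((z - (1 - θ + d) / 2) * (z - (1 - θ - d) / 2)) = 0 := by
    linear_combination hz - hθ - (z - θ) / 4 * hd
  have hlin : 1 - θ ∈ adjoin Fsqrt {θ} := sub_mem (one_mem _) hθM
  change z ∈ adjoin Fsqrt {θ}
  rcases mul_eq_zero.mp hprod with h | h
  · exact sub_eq_zero.mp h ▸ hθM
  · rcases mul_eq_zero.mp h with h | h
    · exact sub_eq_zero.mp h ▸ div_mem (add_mem hlin hdM) (hnum 2)
    · exact sub_eq_zero.mp h ▸ div_mem (sub_mem hlin hdM) (hnum 2)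

end SplittingField

open IntermediateField in
lemma exists_powerBasis_Esplit :
    ∃ pb : PowerBasis Fsqrt (extendScalars Fsqrt_le_Esplit),
      pb.dim = 3 ∧ pb.gen ^ 3 - pb.gen ^ 2 + 1 = 0 := by
  obtain ⟨θ, hθ⟩ := exists_root_cubic
  have haeval : aeval θ (X ^ 3 - X ^ 2 + 1 : Fsqrt[X]) = 0 := by simpa using hθ
  have hint : IsIntegral Fsqrt θ := IsAlgebraic.isIntegral ⟨_, (monic_cubic Fsqrt).ne_zero, haeval⟩
  rw [extendScalars_eq_adjoin_root hθ]
  refine ⟨adjoin.powerBasis hint, ?_, ?_⟩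
  · rw [adjoin.powerBasis_dim, ← minpoly.eq_of_irreducible_of_monic irreducible_cubic_Fsqrt haeval
      (monic_cubic _), natDegree_cubic]
  · rw [adjoin.powerBasis_gen]
    exact Subtype.ext (by simpa using hθ)

/-- `3` is not a norm of the extension `E / F`, where `E` is the splitting field of
`X ^ 3 - X ^ 2 + 1` over `ℚ` and `F = ℚ(√(-23))`; consequently the class of `3` in
`F^× / N_{E/F}(E^×)` has order exactly `3`. -/
theorem three_not_norm :
    ∃ h : Fsqrt ≤ Esplit,
      (∀ α : (IntermediateField.extendScalars h),
        Algebra.norm Fsqrt α ≠ 3) ∧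
      orderOf (QuotientGroup.mk (Units.mk0 (3 : Fsqrt) (by norm_num)) :
        (Fsqrt)ˣ ⧸ (Units.map
          (Algebra.norm (Fsqrt : IntermediateField ℚ ℂ) :
            (IntermediateField.extendScalars h) →* Fsqrt)).range) = 3 := by
  obtain ⟨pb, hdim, hgen⟩ := exists_powerBasis_Esplit
  have hnorm (α : IntermediateField.extendScalars Fsqrt_le_Esplit) :
      Algebra.norm Fsqrt α ≠ 3 := by
    intro h
    obtain ⟨σ⟩ := exists_ringHom_Fsqrt_padic
    obtain ⟨a, b, c, habc⟩ := norm_eq_cubicNormForm pb hdim hgen α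
    refine cubicNormForm_padic_ne_three (σ a) (σ b) (σ c) ?_
    rw [← map_cubicNormForm, ← habc, h, map_ofNat]
  refine ⟨Fsqrt_le_Esplit, hnorm, ?_⟩
  have : Fact (Nat.Prime 3) := ⟨Nat.prime_three⟩
  refine orderOf_eq_prime ?_ ?_
  · rw [← QuotientGroup.mk_pow, QuotientGroup.eq_one_iff]
    refine ⟨Units.mk0 3 (by norm_num), Units.ext ?_⟩
    have h := Algebra.norm_algebraMap (S := IntermediateField.extendScalars Fsqrt_le_Esplit)
      (3 : Fsqrt)
    rw [pb.finrank, hdim, map_ofNat] at h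
    exact h
  · rw [Ne, QuotientGroup.eq_one_iff]
    rintro ⟨u, hu⟩
    exact hnorm u (congrArg Units.val hu)
end
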